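/- For every real ℓ > 0 and every integer n ≥ 2, the mean ℓ displacement over the corner vertices, ξ'(n,ℓ) = [Σ_{x∈C_n} |x|^ℓ F(n,x)] / [Σ_{x∈C_n} F(n,x)], equals [ 2^{nℓ+1} + (2/3)(1 + 3^{ℓ/2}) + (2^{nℓ}(1 + (√3/2)^ℓ) − 2^ℓ − (2√3)^ℓ)/(2^ℓ − 1) ] / (2n + 1/3). -/

import Mathlib

open scoped Classical
open Filter Topology

noncomputable section

namespace SierpinskiGasket

/-- √3 -/
def sq3 : ℝ := Real.sqrt 3

/-- the origin, leftmost outmost vertex of every `SG n` -/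
def o : ℝ × ℝ := (0, 0)

/-- `a m = (2^m, 0)`, the rightmost vertex of `SG m` (also a translation vector). -/
def a (m : ℕ) : ℝ × ℝ := ((2:ℝ) ^ m, 0)

/-- `b m = (2^(m-1), 2^(m-1)·√3)`, the topmost vertex of `SG m`. -/
def b (m : ℕ) : ℝ × ℝ := ((2:ℝ) ^ m / 2, (2:ℝ) ^ m / 2 * sq3)

/-- `c m = (3·2^(m-1), 2^(m-1)·√3)`. -/
def c (m : ℕ) : ℝ × ℝ := (3 * (2:ℝ) ^ m / 2, (2:ℝ) ^ m / 2 * sq3)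

/-- vertex set of `SG n` -/
def V : ℕ → Set (ℝ × ℝ)
  | 0 => {o, a 0, b 0}
  | n + 1 => V n ∪ ((· + a n) '' V n) ∪ ((· + b n) '' V n)

/-- edge set of `SG n` -/
def E : ℕ → Set (Sym2 (ℝ × ℝ))
  | 0 => {s(o, a 0), s(o, b 0), s(a 0, b 0)}
  | n + 1 => E n ∪ (Sym2.map (· + a n) '' E n) ∪ (Sym2.map (· + b n) '' E n)

/-- `SG n` as a simple graph on `ℝ × ℝ` -/
def G (n : ℕ) : SimpleGraph (ℝ × ℝ) := SimpleGraph.fromEdgeSet (E n)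

/-- a Hamiltonian path of `SG n`: a path visiting every vertex of `SG n` exactly once -/
def IsHamPath (n : ℕ) {u v : ℝ × ℝ} (p : (G n).Walk u v) : Prop :=
  p.IsPath ∧ ∀ x, x ∈ p.support ↔ x ∈ V n

/-- a Hamiltonian cycle of `SG n` -/
def IsHamCycle (n : ℕ) {u : ℝ × ℝ} (p : (G n).Walk u u) : Prop :=
  p.IsCycle ∧ ∀ x, x ∈ p.support ↔ x ∈ V n

/-- `f n u v`: the number of Hamiltonian paths of `SG n` with end-vertex set `{u, v}`
(for `u ≠ v`, such unordered paths correspond bijectively to walks from `u` to `v`). -/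
def f (n : ℕ) (u v : ℝ × ℝ) : ℕ := Nat.card {p : (G n).Walk u v // IsHamPath n p}

/-- `f1 n`: the number of Hamiltonian paths of `SG n` with end-vertex set `{o, a n}` -/
def f1 (n : ℕ) : ℕ := f n o (a n)

/-- the number of Hamiltonian cycles of `SG n`, counted up to starting vertex and
orientation: every Hamiltonian cycle passes through `o` and has exactly two
representatives as a closed walk based at `o`. -/
def HC (n : ℕ) : ℕ := Nat.card {p : (G n).Walk o o // IsHamCycle n p} / 2

/-- the number of Hamiltonian paths of `SG n` having `o` as one of their end vertices -/
def H0 (n : ℕ) : ℕ := ∑ᶠ x ∈ {x : ℝ × ℝ | x ≠ o}, f n o x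

/-- the total number of Hamiltonian paths of `SG n` (a path and its reversal
are the same unordered object, whence the division by `2`). -/
def H (n : ℕ) : ℕ := (∑ᶠ u : ℝ × ℝ, ∑ᶠ v : ℝ × ℝ, f n u v) / 2

/-- the distribution ratio `F(n,x) = f(n,x)/f1(n)` -/
def F (n : ℕ) (x : ℝ × ℝ) : ℝ := (f n o x : ℝ) / (f1 n : ℝ)

/-- `SG n` with the vertex `b n` (and its incident edges) deleted -/
def Gd (n : ℕ) : SimpleGraph (ℝ × ℝ) := SimpleGraph.fromEdgeSet {e ∈ E n | b n ∉ e}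

/-- Hamiltonian path of `SG n - b n` -/
def IsHamPathD (n : ℕ) {u v : ℝ × ℝ} (p : (Gd n).Walk u v) : Prop :=
  p.IsPath ∧ ∀ x, x ∈ p.support ↔ (x ∈ V n ∧ x ≠ b n)

/-- `g2 n x`: the number of Hamiltonian paths of `SG n - b n` with end-vertex set `{o, x}` -/
def g2 (n : ℕ) (x : ℝ × ℝ) : ℕ := Nat.card {p : (Gd n).Walk o x // IsHamPathD n p}

/-- `g1 n`: the number of Hamiltonian paths of `SG n - b n` with end-vertex set `{o, a n}` -/
def g1 (n : ℕ) : ℕ := g2 n (a n)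

/-- the distribution ratio `G₂(n,x) = g₂(n,x)/g₁(n)` -/
def G2 (n : ℕ) (x : ℝ × ℝ) : ℝ := (g2 n x : ℝ) / (g1 n : ℝ)

/-- mid-side vertex `a_{m,1} = (3·2^(m-1), 0)` -/
def a1 (m : ℕ) : ℝ × ℝ := (3 * (2:ℝ) ^ m / 2, 0)

/-- mid-side vertex `b_{m,1} = (5·2^(m-2), 2^(m-2)·√3)` -/
def b1 (m : ℕ) : ℝ × ℝ := (5 * (2:ℝ) ^ m / 4, (2:ℝ) ^ m / 4 * sq3)

/-- mid-side vertex `c_{m,1} = (7·2^(m-2), 2^(m-2)·√3)` -/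
def c1 (m : ℕ) : ℝ × ℝ := (7 * (2:ℝ) ^ m / 4, (2:ℝ) ^ m / 4 * sq3)

/-- mid-side vertex `a_{m,2} = (2^m, 2^(m-1)·√3)` -/
def a2 (m : ℕ) : ℝ × ℝ := ((2:ℝ) ^ m, (2:ℝ) ^ m / 2 * sq3)

/-- mid-side vertex `b_{m,2} = (3·2^(m-2), 3·2^(m-2)·√3)` -/
def b2 (m : ℕ) : ℝ × ℝ := (3 * (2:ℝ) ^ m / 4, 3 * (2:ℝ) ^ m / 4 * sq3)

/-- mid-side vertex `c_{m,2} = (5·2^(m-2), 3·2^(m-2)·√3)` -/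
def c2 (m : ℕ) : ℝ × ℝ := (5 * (2:ℝ) ^ m / 4, 3 * (2:ℝ) ^ m / 4 * sq3)

/-- exceptional vertex `a* = (2^(n-1), (2^(n-1)-1)·√3)` -/
def astar (n : ℕ) : ℝ × ℝ := ((2:ℝ) ^ n / 2, ((2:ℝ) ^ n / 2 - 1) * sq3)

/-- exceptional vertex `b* = (2^(n-1) - 1/2, (2^n-1)·√3/2)` -/
def bstar (n : ℕ) : ℝ × ℝ := ((2:ℝ) ^ n / 2 - 1/2, ((2:ℝ) ^ n - 1) * sq3 / 2)

/-- exceptional vertex `c* = (2^(n-1) + 1/2, (2^n-1)·√3/2)` -/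
def cstar (n : ℕ) : ℝ × ℝ := ((2:ℝ) ^ n / 2 + 1/2, ((2:ℝ) ^ n - 1) * sq3 / 2)

/-- the Euclidean norm on `ℝ × ℝ` -/
def enorm (x : ℝ × ℝ) : ℝ := Real.sqrt (x.1 ^ 2 + x.2 ^ 2)

/-- the set `C n` of corner vertices of `SG n` -/
def C (n : ℕ) : Finset (ℝ × ℝ) :=
  ((Finset.range (n + 1)).image a) ∪ ((Finset.range (n + 1)).image b) ∪
    ((Finset.range n).image c)

/-- the mean `ℓ` displacement over the corner vertices -/
def xi' (n : ℕ) (ℓ : ℝ) : ℝ :=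
  (∑ x ∈ C n, enorm x ^ ℓ * F n x) / (∑ x ∈ C n, F n x)

/-- `p(n,x)`: the probability that a Hamiltonian path with one end at `o`
has its other end at `x` -/
def p (n : ℕ) (x : ℝ × ℝ) : ℝ := (f n o x : ℝ) / (H0 n : ℝ)

/-- the mean `ℓ` displacement of Hamiltonian paths on `SG n` with one end at `o` -/
def xi (n : ℕ) (ℓ : ℝ) : ℝ :=
  ∑ᶠ x ∈ {x : ℝ × ℝ | x ∈ V n ∧ x ≠ o}, enorm x ^ ℓ * p n x

/-- the partition function of Hamiltonian paths on `SG n` -/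
def Z (n : ℕ) (β : ℝ) : ℝ := (H n : ℝ) * Real.exp (-(β * ((3 ^ (n + 1) + 1) / 2)))

/-! ### Routes: paths recorded as the list of vertices after the starting point -/

section Routes

variable {α : Type*}

/-- `IsRoute E u l v`: the sequence `u :: l` runs along edges of `E` and ends at `v`. -/
def IsRoute (E : Set (Sym2 α)) : α → List α → α → Prop
  | u, [], v => u = v
  | u, w :: l, v => s(u, w) ∈ E ∧ IsRoute E w l v

theorem IsRoute.append {E : Set (Sym2 α)} {u s v : α} {l m : List α}
    (h : IsRoute E u l s) (h' : IsRoute E s m v) : IsRoute E u (l ++ m) v := by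
  induction l generalizing u with
  | nil => cases h; exact h'
  | cons w l ih => exact ⟨h.1, ih h.2⟩

theorem IsRoute.mono {E E' : Set (Sym2 α)} (hE : ∀ e ∈ E, e ∈ E') {u v : α} {l : List α}
    (h : IsRoute E u l v) : IsRoute E' u l v := by
  induction l generalizing u with
  | nil => exact h
  | cons w l ih => exact ⟨hE _ h.1, ih h.2⟩

theorem IsRoute.end_mem {E : Set (Sym2 α)} {u v : α} {l : List α} (h : IsRoute E u l v) :
    v ∈ u :: l := by
  induction l generalizing u with
  | nil => cases h; simp
  | cons w l ih => exact List.mem_cons_of_mem _ (ih h.2)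

theorem IsRoute.end_mem_of_ne_nil {E : Set (Sym2 α)} {u v : α} {l : List α}
    (h : IsRoute E u l v) (hl : l ≠ []) : v ∈ l := by
  cases l with
  | nil => exact absurd rfl hl
  | cons w l => exact h.2.end_mem

theorem IsRoute.drop {E E' : Set (Sym2 α)} {u s v : α} {l m : List α}
    (h : IsRoute E u (l ++ m) v) (h' : IsRoute E' u l s) : IsRoute E s m v := by
  induction l generalizing u with
  | nil => cases h'; exact h
  | cons w l ih => exact ih h.2 h'.2

theorem IsRoute.mem_of_mem {E : Set (Sym2 α)} {W : Set α}
    (hE : ∀ u v, s(u, v) ∈ E → u ∈ W) {u v : α} {l : List α}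
    (h : IsRoute E u l v) (hu : u ∈ W) : ∀ a ∈ u :: l, a ∈ W := by
  induction l generalizing u with
  | nil => simpa using hu
  | cons w l ih =>
    have hw : w ∈ W := hE w u (Sym2.eq_swap ▸ h.1)
    have := ih h.2 hw
    grind

theorem IsRoute.eq_nil {E : Set (Sym2 α)} {u : α} {l : List α} (h : IsRoute E u l u)
    (hn : (u :: l).Nodup) : l = [] := by
  by_contra hl
  exact (List.nodup_cons.1 hn).1 (h.end_mem_of_ne_nil hl)

/-- The vertices of the sequence `u :: l`. -/
def Supp (u : α) (l : List α) : Set α := {a | a ∈ u :: l}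

/-- The sequence `u :: l` has no repetition. -/
def Simple (u : α) (l : List α) : Prop := (u :: l).Nodup

theorem start_mem_supp (u : α) (l : List α) : u ∈ Supp u l := List.mem_cons_self

theorem mem_supp_nil {u a : α} : a ∈ Supp u [] ↔ a = u := List.mem_singleton

theorem simple_nil (u : α) : Simple u [] := List.nodup_singleton u

theorem IsRoute.end_mem_supp {E : Set (Sym2 α)} {u v : α} {l : List α} (h : IsRoute E u l v) :
    v ∈ Supp u l := h.end_mem

theorem IsRoute.supp_subset {E : Set (Sym2 α)} {W : Set α}
    (hE : ∀ u v, s(u, v) ∈ E → u ∈ W) {u v : α} {l : List α}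
    (h : IsRoute E u l v) (hu : u ∈ W) : ∀ a, a ∈ Supp u l → a ∈ W := h.mem_of_mem hE hu

/-- Supports of consecutive segments. -/
theorem IsRoute.mem_append_iff {E : Set (Sym2 α)} {u s : α} {l m : List α}
    (h : IsRoute E u l s) (a : α) : a ∈ Supp u (l ++ m) ↔ a ∈ Supp u l ∨ a ∈ Supp s m := by
  have := h.end_mem
  simp only [Supp, Set.mem_ofPred_eq]
  grind

/-- Simplicity of a concatenation in terms of its segments. -/
theorem IsRoute.nodup_append_iff {E : Set (Sym2 α)} {u s : α} {l m : List α}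
    (h : IsRoute E u l s) : Simple u (l ++ m) ↔
      Simple u l ∧ Simple s m ∧ ∀ a, a ∈ Supp u l → a ∈ Supp s m → a = s := by
  have hs := h.end_mem
  simp only [Supp, Simple, Set.mem_ofPred_eq]
  rw [← List.cons_append, List.nodup_append, List.nodup_cons (a := s)]
  grind

/-- A simple list splits in at most one way at a given vertex. -/
theorem IsRoute.split_unique {E E' : Set (Sym2 α)} {u s : α} {l m l' m' : List α}
    (h : IsRoute E u l s) (h' : IsRoute E' u l' s) (hn : Simple u (l ++ m))
    (he : l ++ m = l' ++ m') : l = l' ∧ m = m' := by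
  have key : ∀ {E E' : Set (Sym2 α)} {l m l' : List α}, IsRoute E u l s → IsRoute E' u l' s →
      Simple u (l ++ m) → ∀ t, l' = l ++ t → m = t ++ m' → t = [] := by
    intro E E' l m l' h h' hn t ht hm
    subst ht
    have h2 := h'.drop h
    refine h2.eq_nil ?_
    have := (h.nodup_append_iff.1 hn).2.1
    rw [hm, Simple, ← List.cons_append] at this
    exact (List.nodup_append.1 this).1
  rcases List.append_eq_append_iff.1 he with ⟨t, h1, h2⟩ | ⟨t, h1, h2⟩
  · obtain rfl := key h h' hn t h1 h2
    simp_all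
  · have key' : t = [] := by
      subst h1
      have h3 := h.drop h'
      refine h3.eq_nil ?_
      rw [List.append_assoc] at hn
      have := (h'.nodup_append_iff.1 hn).2.1
      rw [Simple, ← List.cons_append] at this
      exact (List.nodup_append.1 this).1
    subst key'
    simp_all

/-- Simple routes of `E` from `u` to `v` with vertex set `W`. -/
def Ham (E : Set (Sym2 α)) (u v : α) (W : Set α) : Set (List α) :=
  {l | IsRoute E u l v ∧ Simple u l ∧ ∀ a, a ∈ Supp u l ↔ a ∈ W}

/-- Pairs of disjoint simple routes, from `u` to `v` and from `w` to `z`, covering `W`. -/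
def Ham2 (E : Set (Sym2 α)) (u v w z : α) (W : Set α) : Set (List α × List α) :=
  {l | IsRoute E u l.1 v ∧ IsRoute E w l.2 z ∧ Simple u l.1 ∧ Simple w l.2 ∧
    (∀ a, a ∈ Supp u l.1 → a ∉ Supp w l.2) ∧ ∀ a, a ∈ Supp u l.1 ∨ a ∈ Supp w l.2 ↔ a ∈ W}

theorem finite_nodup {W : Set α} (hW : W.Finite) :
    {l : List α | l.Nodup ∧ ∀ a ∈ l, a ∈ W}.Finite := by
  refine (hW.toFinset.powerset.finite_toSet.biUnion
    (fun s _ => s.toList.permutations.toFinset.finite_toSet)).subset ?_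
  rintro l ⟨hn, hl⟩
  simp only [Set.mem_iUnion]
  refine ⟨l.toFinset, by simpa [Set.subset_def] using hl, ?_⟩
  simp only [List.coe_toFinset, Set.mem_ofPred_eq, List.mem_permutations]
  exact (List.perm_ext_iff_of_nodup hn (Finset.nodup_toList _)).2 (by simp)

theorem finite_ham {E : Set (Sym2 α)} {u v : α} {W : Set α} (hW : W.Finite) :
    (Ham E u v W).Finite := by
  refine (finite_nodup hW).subset ?_
  rintro l ⟨_, h2, h3⟩
  exact ⟨(List.nodup_cons.1 h2).2, fun a ha => (h3 a).1 (List.mem_cons_of_mem _ ha)⟩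

/-- Three pieces with vertex sets `VA`, `VB`, `VC` and edge sets `EA`, `EB`, `EC`, glued
pairwise at the three distinct vertices `p`, `q`, `r`. -/
structure Glued (E EA EB EC : Set (Sym2 α)) (VA VB VC : Set α) (p q r : α) : Prop where
  edge : ∀ e, e ∈ E ↔ e ∈ EA ∨ e ∈ EB ∨ e ∈ EC
  memA : ∀ u v, s(u, v) ∈ EA → u ∈ VA
  memB : ∀ u v, s(u, v) ∈ EB → u ∈ VB
  memC : ∀ u v, s(u, v) ∈ EC → u ∈ VC
  ab : ∀ a, a ∈ VA → a ∈ VB → a = p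
  ac : ∀ a, a ∈ VA → a ∈ VC → a = q
  bc : ∀ a, a ∈ VB → a ∈ VC → a = r
  pA : p ∈ VA
  pB : p ∈ VB
  qA : q ∈ VA
  qC : q ∈ VC
  rB : r ∈ VB
  rC : r ∈ VC
  pq : p ≠ q
  pr : p ≠ r
  qr : q ≠ r

variable {E EA EB EC : Set (Sym2 α)} {VA VB VC : Set α} {p q r : α}

theorem Glued.rot (h : Glued E EA EB EC VA VB VC p q r) :
    Glued E EB EC EA VB VC VA r p q where
  edge e := by rw [h.edge]; tauto
  memA := h.memB
  memB := h.memC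
  memC := h.memA
  ab := h.bc
  ac a h1 h2 := h.ab a h2 h1
  bc a h1 h2 := h.ac a h2 h1
  pA := h.rB
  pB := h.rC
  qA := h.pB
  qC := h.pA
  rB := h.qC
  rC := h.qA
  pq := h.pr.symm
  pr := h.qr.symm
  qr := h.pq

theorem Glued.flip (h : Glued E EA EB EC VA VB VC p q r) :
    Glued E EA EC EB VA VC VB q p r where
  edge e := by rw [h.edge]; tauto
  memA := h.memA
  memB := h.memC
  memC := h.memB
  ab := h.ac
  ac := h.ab
  bc a h1 h2 := h.bc a h2 h1
  pA := h.qA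
  pB := h.qC
  qA := h.pA
  qC := h.pB
  rB := h.rC
  rC := h.rB
  pq := h.pq.symm
  pr := h.qr
  qr := h.pr

/-- A route of `E` whose first edge belongs to `E'`. -/
def Enter (E E' : Set (Sym2 α)) (u : α) (l : List α) (v : α) : Prop :=
  ∃ w l', l = w :: l' ∧ s(u, w) ∈ E' ∧ IsRoute E w l' v

theorem Glued.exit (h : Glued E EA EB EC VA VB VC p q r) {u v : α} {l : List α}
    (hl : IsRoute E u l v) (hu : u ∈ VA) :
    IsRoute EA u l v ∨
      (∃ l₁ l₂, l = l₁ ++ l₂ ∧ IsRoute EA u l₁ p ∧ Enter E EB p l₂ v) ∨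
      (∃ l₁ l₂, l = l₁ ++ l₂ ∧ IsRoute EA u l₁ q ∧ Enter E EC q l₂ v) := by
  induction l generalizing u with
  | nil => exact .inl hl
  | cons w l ih =>
    obtain ⟨h1, h2⟩ := hl
    rcases (h.edge _).1 h1 with h3 | h3 | h3
    · rcases ih h2 (h.memA w u (Sym2.eq_swap ▸ h3)) with h4 | ⟨l₁, l₂, rfl, h5, h6⟩ |
        ⟨l₁, l₂, rfl, h5, h6⟩
      · exact .inl ⟨h3, h4⟩
      · exact .inr (.inl ⟨w :: l₁, l₂, rfl, ⟨h3, h5⟩, h6⟩)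
      · exact .inr (.inr ⟨w :: l₁, l₂, rfl, ⟨h3, h5⟩, h6⟩)
    · obtain rfl := h.ab u hu (h.memB _ _ h3)
      exact .inr (.inl ⟨[], w :: l, rfl, rfl, w, l, rfl, h3, h2⟩)
    · obtain rfl := h.ac u hu (h.memC _ _ h3)
      exact .inr (.inr ⟨[], w :: l, rfl, rfl, w, l, rfl, h3, h2⟩)

/-- A simple route entering the second piece at `p` can only leave it at `r`. -/
theorem Glued.step (h : Glued E EA EB EC VA VB VC p q r) {v : α} {l : List α}
    (hl : Enter E EB p l v) (hn : Simple p l) :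
    IsRoute EB p l v ∨
      ∃ l₁ l₂, l = l₁ ++ l₂ ∧ IsRoute EB p l₁ r ∧ Enter E EC r l₂ v := by
  obtain ⟨w, l', rfl, h1, h2⟩ := hl
  rcases h.rot.exit h2 (h.memB w p (Sym2.eq_swap ▸ h1)) with h4 | ⟨l₁, l₂, rfl, h5, h6⟩ |
    ⟨l₁, l₂, rfl, h5, h6⟩
  · exact .inl ⟨h1, h4⟩
  · exact .inr ⟨w :: l₁, l₂, rfl, ⟨h1, h5⟩, h6⟩
  · have := h5.end_mem
    grind [Simple]

/-- A simple route that starts in `EA` and leaves it at `p` towards `EB`. -/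
def Leaves (EA EB EC : Set (Sym2 α)) (p q r u : α) (l : List α) (v : α) : Prop :=
  ∃ l₁ l₂, l = l₁ ++ l₂ ∧ IsRoute EA u l₁ p ∧
    (IsRoute EB p l₂ v ∨ ∃ l₃ l₄, l₂ = l₃ ++ l₄ ∧ IsRoute EB p l₃ r ∧
      (IsRoute EC r l₄ v ∨ ∃ l₅ l₆, l₄ = l₅ ++ l₆ ∧ IsRoute EC r l₅ q ∧ IsRoute EA q l₆ v))

theorem Glued.leaves (h : Glued E EA EB EC VA VB VC p q r) {u v : α} {l₁ l₂ : List α}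
    (h1 : IsRoute EA u l₁ p) (h2 : Enter E EB p l₂ v) (hn : Simple u (l₁ ++ l₂)) :
    Leaves EA EB EC p q r u (l₁ ++ l₂) v := by
  refine ⟨l₁, l₂, rfl, h1, ?_⟩
  have hn2 := (h1.nodup_append_iff.1 hn).2.1
  rcases h.step h2 hn2 with h3 | ⟨l₃, l₄, rfl, h4, h5⟩
  · exact .inl h3
  refine .inr ⟨l₃, l₄, rfl, h4, ?_⟩
  have hn3 := (h4.nodup_append_iff.1 hn2).2.1
  rcases h.rot.step h5 hn3 with h6 | ⟨l₅, l₆, rfl, h7, h8⟩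
  · exact .inl h6
  refine .inr ⟨l₅, l₆, rfl, h7, ?_⟩
  have hn4 := (h7.nodup_append_iff.1 hn3).2.1
  rcases h.rot.rot.step h8 hn4 with h9 | ⟨l₇, l₈, rfl, h9, h10⟩
  · exact h9
  · have := h9.end_mem_of_ne_nil (by
      rintro rfl
      exact h.pq h9.symm)
    grind [Simple]

theorem Glued.cases (h : Glued E EA EB EC VA VB VC p q r) {u v : α} {l : List α}
    (hl : IsRoute E u l v) (hn : Simple u l) (hu : u ∈ VA) :
    IsRoute EA u l v ∨ Leaves EA EB EC p q r u l v ∨ Leaves EA EC EB q p r u l v := by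
  rcases h.exit hl hu with h1 | ⟨l₁, l₂, rfl, h5, h6⟩ | ⟨l₁, l₂, rfl, h5, h6⟩
  · exact .inl h1
  · exact .inr (.inl (h.leaves h5 h6 hn))
  · exact .inr (.inr (h.flip.leaves h5 h6 hn))

theorem ncard_image2_append {S T : Set (List α)} {u s : α}
    (hS : ∀ l ∈ S, IsRoute E u l s) (hn : ∀ l ∈ S, ∀ m ∈ T, Simple u (l ++ m)) :
    (Set.image2 (· ++ ·) S T).ncard = S.ncard * T.ncard := by
  rw [← Set.image_prod, Set.InjOn.ncard_image, Set.ncard_prod]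
  rintro ⟨l, m⟩ ⟨hl, hm⟩ ⟨l', m'⟩ ⟨hl', hm'⟩ he
  obtain ⟨rfl, rfl⟩ := (hS l hl).split_unique (hS l' hl') (hn l hl m hm) he
  rfl

/-- Concatenations of three covering routes `x ⤳ q ⤳ r ⤳ y`. -/
def Cross (EA EC EB : Set (Sym2 α)) (x q r y : α) (WA WC WB : Set α) : Set (List α) :=
  Set.image2 (· ++ ·) (Ham EA x q WA)
    (Set.image2 (· ++ ·) (Ham EC q r WC) (Ham EB r y WB))

theorem Glued.simple_cross (h : Glued E EA EB EC VA VB VC p q r) {x y : α}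
    {WA WB WC : Set α} (hA : WA ⊆ VA) (hB : WB ⊆ VB) (hC : WC ⊆ VC) (hp : p ∈ WA → p ∉ WB)
    {l₁ l₃ l₄ : List α} (h1 : l₁ ∈ Ham EA x q WA) (h3 : l₃ ∈ Ham EC q r WC)
    (h4 : l₄ ∈ Ham EB r y WB) :
    Simple x (l₁ ++ (l₃ ++ l₄)) ∧ Simple q (l₃ ++ l₄) := by
  obtain ⟨r1, n1, s1⟩ := h1
  obtain ⟨r3, n3, s3⟩ := h3
  obtain ⟨r4, n4, s4⟩ := h4
  simp only [r1.nodup_append_iff, r3.nodup_append_iff, r3.mem_append_iff, s1, s3, s4]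
  have := h.ab
  have := h.ac
  have := h.bc
  grind

theorem Glued.ham_cross (h : Glued E EA EB EC VA VB VC p q r) {x y : α} {WC : Set α}
    (hx : x ∈ VA) (hy : y ∈ VB) (hyp : y ≠ p) (hyr : y ≠ r)
    (hC : WC ⊆ VC) (hq : q ∈ WC) (hr : r ∈ WC) :
    Ham E x y (VA ∪ VB ∪ WC) =
      Cross EA EC EB x q r y VA WC (VB \ {p}) ∪ Cross EA EC EB x q r y (VA \ {p}) WC VB ∪
        {l | (∀ w ∈ WC, w = q ∨ w = r) ∧
          l ∈ Set.image2 (· ++ ·) (Ham EA x p VA) (Ham EB p y VB)} := by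
  obtain ⟨edge, memA, memB, memC, ab, ac, bc, pA, pB, qA, qC, rB, rC, pq, pr, qr⟩ := id h
  have hA : ∀ e ∈ EA, e ∈ E := fun e he => (edge e).2 (.inl he)
  have hB : ∀ e ∈ EB, e ∈ E := fun e he => (edge e).2 (.inr (.inl he))
  have hC' : ∀ e ∈ EC, e ∈ E := fun e he => (edge e).2 (.inr (.inr he))
  have hyA : y ∉ VA := fun hh => hyp (ab y hh hy)
  have hyC : y ∉ VC := fun hh => hyr (bc y hy hh)
  have hpC : p ∉ VC := fun hh => pq (ac p pA hh)
  have hqB : q ∉ VB := fun hh => pq (ab q qA hh).symm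
  have hrA : r ∉ VA := fun hh => pr (ab r hh rB).symm
  apply Set.Subset.antisymm
  · rintro l ⟨hl, hn, hs⟩
    simp only [Set.mem_union] at hs
    rcases h.cases hl hn hx with h1 | ⟨l₁, l₂, rfl, h1, h2⟩ | ⟨l₁, l₂, rfl, h1, h2⟩
    · exact absurd (h1.supp_subset memA hx _ h1.end_mem_supp) hyA
    · have u1 := h1.supp_subset memA hx
      rcases h2 with h2 | ⟨l₃, l₄, rfl, h3, h4 | ⟨l₅, l₆, rfl, h5, h6⟩⟩
      · have u2 := h2.supp_subset memB pB
        simp only [h1.nodup_append_iff] at hn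
        simp only [h1.mem_append_iff] at hs
        have := h1.end_mem_supp
        have := start_mem_supp p l₂
        refine .inr ⟨?_, l₁, ⟨h1, hn.1, ?_⟩, l₂, ⟨h2, hn.2.1, ?_⟩, rfl⟩ <;> grind
      · exact absurd (h4.supp_subset memC rC _ h4.end_mem_supp) hyC
      · exact absurd (h6.supp_subset memA qA _ h6.end_mem_supp) hyA
    · have u1 := h1.supp_subset memA hx
      rcases h2 with h2 | ⟨l₃, l₄, rfl, h3, h4 | ⟨l₅, l₆, rfl, h5, h6⟩⟩
      · exact absurd (h2.supp_subset memC qC _ h2.end_mem_supp) hyC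
      · have u3 := h3.supp_subset memC qC
        have u4 := h4.supp_subset memB rB
        simp only [h1.nodup_append_iff, h3.nodup_append_iff, h3.mem_append_iff] at hn
        simp only [h1.mem_append_iff, h3.mem_append_iff] at hs
        have := h1.end_mem_supp
        have := h3.end_mem_supp
        have := start_mem_supp q l₃
        have := start_mem_supp r l₄
        have e (W : Set α) (a : α) : a ∈ W \ {p} ↔ a ∈ W ∧ a ≠ p := Iff.rfl
        by_cases hp : p ∈ Supp x l₁
        · refine .inl (.inl ⟨l₁, ⟨h1, hn.1, ?_⟩, _, ⟨l₃, ⟨h3, hn.2.1.1, ?_⟩, l₄,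
            ⟨h4, hn.2.1.2.1, ?_⟩, rfl⟩, rfl⟩)
          all_goals grind
        · refine .inl (.inr ⟨l₁, ⟨h1, hn.1, ?_⟩, _, ⟨l₃, ⟨h3, hn.2.1.1, ?_⟩, l₄,
            ⟨h4, hn.2.1.2.1, ?_⟩, rfl⟩, rfl⟩)
          all_goals grind
      · exact absurd (h6.supp_subset memA pA _ h6.end_mem_supp) hyA
  · rintro l ((⟨l₁, k1, _, ⟨l₃, k3, l₄, k4, rfl⟩, rfl⟩ |
      ⟨l₁, k1, _, ⟨l₃, k3, l₄, k4, rfl⟩, rfl⟩) | ⟨hw, l₁, k1, l₂, k2, rfl⟩)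
    · refine ⟨(k1.1.mono hA).append ((k3.1.mono hC').append (k4.1.mono hB)),
        (h.simple_cross subset_rfl Set.sdiff_subset hC (by simp) k1 k3 k4).1, ?_⟩
      simp only [k1.1.mem_append_iff, k3.1.mem_append_iff, k1.2.2, k3.2.2, k4.2.2,
        Set.mem_union, Set.mem_sdiff, Set.mem_singleton_iff]
      grind
    · refine ⟨(k1.1.mono hA).append ((k3.1.mono hC').append (k4.1.mono hB)),
        (h.simple_cross Set.sdiff_subset subset_rfl hC (by simp) k1 k3 k4).1, ?_⟩
      simp only [k1.1.mem_append_iff, k3.1.mem_append_iff, k1.2.2, k3.2.2, k4.2.2,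
        Set.mem_union, Set.mem_sdiff, Set.mem_singleton_iff]
      grind
    · refine ⟨(k1.1.mono hA).append (k2.1.mono hB), ?_, ?_⟩
      · rw [k1.1.nodup_append_iff]
        refine ⟨k1.2.1, k2.2.1, ?_⟩
        simp only [k1.2.2, k2.2.2]
        exact ab
      · simp only [k1.1.mem_append_iff, k1.2.2, k2.2.2, Set.mem_union]
        grind

theorem Ham.simple_append {E E' : Set (Sym2 α)} {u s v : α} {W W' : Set α} {l m : List α}
    (hl : l ∈ Ham E u s W) (hm : m ∈ Ham E' s v W') (hW : ∀ a ∈ W, a ∈ W' → a = s) :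
    Simple u (l ++ m) := by
  rw [hl.1.nodup_append_iff]
  simp only [hl.2.2, hm.2.2]
  exact ⟨hl.2.1, hm.2.1, hW⟩

theorem Glued.ncard_cross (h : Glued E EA EB EC VA VB VC p q r) {x y : α}
    {WA WB WC : Set α} (hA : WA ⊆ VA) (hB : WB ⊆ VB) (hC : WC ⊆ VC) (hp : p ∈ WA → p ∉ WB) :
    (Cross EA EC EB x q r y WA WC WB).ncard =
      (Ham EA x q WA).ncard * ((Ham EC q r WC).ncard * (Ham EB r y WB).ncard) := by
  rw [Cross, ncard_image2_append (fun l hl => hl.1), ncard_image2_append (fun l hl => hl.1)]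
  · exact fun l hl m hm => Ham.simple_append hl hm fun a ha hb => h.bc a (hB hb) (hC ha)
  · rintro l hl _ ⟨m, hm, k, hk, rfl⟩
    exact (h.simple_cross hA hB hC hp hl hm hk).1

theorem Glued.disjoint_cross (h : Glued E EA EB EC VA VB VC p q r) {x y : α} {WC : Set α}
    (hC : WC ⊆ VC) :
    Disjoint (Cross EA EC EB x q r y VA WC (VB \ {p}))
      (Cross EA EC EB x q r y (VA \ {p}) WC VB) := by
  rw [Set.disjoint_left]
  rintro _ ⟨l₁, k1, _, ⟨l₃, k3, l₄, k4, rfl⟩, rfl⟩ ⟨m₁, j1, _, ⟨m₃, j3, m₄, j4, rfl⟩, he⟩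
  obtain ⟨rfl, -⟩ := j1.1.split_unique k1.1
    (h.simple_cross Set.sdiff_subset subset_rfl hC (by simp) j1 j3 j4).1 he
  exact ((j1.2.2 p).1 ((k1.2.2 p).2 h.pA)).2 rfl

theorem Glued.not_cross_of_direct (h : Glued E EA EB EC VA VB VC p q r) {x y : α}
    {WA WB WC : Set α} (hA : WA ⊆ VA) (hB : WB ⊆ VB) (hC : WC ⊆ VC) (hp : p ∈ WA → p ∉ WB)
    {l : List α} (hl : l ∈ Set.image2 (· ++ ·) (Ham EA x p VA) (Ham EB p y VB)) :
    l ∉ Cross EA EC EB x q r y WA WC WB := by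
  obtain ⟨edge, memA, memB, memC, ab, ac, bc, pA, pB, qA, qC, rB, rC, pq, pr, qr⟩ := id h
  obtain ⟨l₁, k1, l₂, k2, rfl⟩ := hl
  rintro ⟨m₁, j1, _, ⟨m₃, j3, m₄, j4, rfl⟩, he⟩
  dsimp only at he
  have hqB : q ∉ VB := fun hh => pq (ab q qA hh).symm
  have hrA : r ∉ VA := fun hh => pr (ab r hh rB).symm
  have hpC : p ∉ VC := fun hh => pq (ac p pA hh)
  have hn := h.simple_cross hA hB hC hp j1 j3 j4
  rw [← List.append_assoc] at he hn
  rcases List.append_eq_append_iff.1 he with ⟨t, h1, h2⟩ | ⟨t, h1, h2⟩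
  · have h5 : r ∈ Supp x (m₁ ++ m₃) := (j1.1.mem_append_iff r).2 (.inr j3.1.end_mem_supp)
    have h6 : r ∈ Supp x l₁ := by
      rw [h1]
      simp only [Supp, Set.mem_ofPred_eq] at h5 ⊢
      grind
    exact hrA ((k1.2.2 r).1 h6)
  · have hm : IsRoute (EA ∪ EC) x (m₁ ++ m₃) r :=
      (j1.1.mono fun _ h => .inl h).append (j3.1.mono fun _ h => .inr h)
    have h7 : p ∈ Supp x (m₁ ++ m₃) := by
      have := k1.1.end_mem_supp
      rw [h1]
      simp only [Supp, Set.mem_ofPred_eq] at this ⊢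
      grind
    have h8 : q ∈ Supp x l₁ := (k1.2.2 q).2 h.qA
    have hlen := (j1.1.mem_append_iff p).1 h7
    simp only [j1.2.2, j3.2.2] at hlen
    have hpA : p ∈ WA := by
      rcases hlen with h | h
      · exact h
      · exact absurd (hC h) hpC
    have hle : m₁ ++ (m₃ ++ m₄) = l₁ ++ l₂ := by rw [← List.append_assoc, he]
    have hp1 : p ∈ Supp x m₁ := (j1.2.2 p).2 hpA
    have hn' := (h.simple_cross hA hB hC hp j1 j3 j4).1
    rcases List.append_eq_append_iff.1 hle with ⟨s, h9, h10⟩ | ⟨s, h9, h10⟩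
    · subst h9
      have hps := (k1.1.drop j1.1)
      by_cases hs : s = []
      · subst hs
        exact pq hps.symm
      · have hps' := hps.end_mem_of_ne_nil hs
        rw [h10, ← List.append_assoc] at hn'
        simp only [Simple, Supp, Set.mem_ofPred_eq] at hn' hp1
        grind
    · subst h9
      have hps := (j1.1.drop k1.1)
      by_cases hs : s = []
      · subst hs
        exact pq hps
      · have hps' := hps.end_mem_of_ne_nil hs
        rw [List.append_assoc] at hn'
        simp only [Simple, Supp, Set.mem_ofPred_eq] at hn' h8
        grind

theorem Glued.ncard_ham_cross (h : Glued E EA EB EC VA VB VC p q r) {x y : α} {WC : Set α}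
    (hx : x ∈ VA) (hy : y ∈ VB) (hyp : y ≠ p) (hyr : y ≠ r)
    (hC : WC ⊆ VC) (hq : q ∈ WC) (hr : r ∈ WC) (fA : VA.Finite) (fB : VB.Finite)
    (fC : VC.Finite) :
    (Ham E x y (VA ∪ VB ∪ WC)).ncard =
      (Ham EA x q VA).ncard * ((Ham EC q r WC).ncard * (Ham EB r y (VB \ {p})).ncard) +
      (Ham EA x q (VA \ {p})).ncard * ((Ham EC q r WC).ncard * (Ham EB r y VB).ncard) +
      if ∀ w ∈ WC, w = q ∨ w = r then (Ham EA x p VA).ncard * (Ham EB p y VB).ncard else 0 := by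
  have fin : (Ham E x y (VA ∪ VB ∪ WC)).Finite :=
    finite_ham ((fA.union fB).union (fC.subset hC))
  have hne := h.ham_cross hx hy hyp hyr hC hq hr
  rw [hne] at fin ⊢
  have fin12 := fin.subset Set.subset_union_left
  rw [Set.ncard_union_eq ?_ fin12 (fin.subset Set.subset_union_right),
    Set.ncard_union_eq (h.disjoint_cross hC) (fin12.subset Set.subset_union_left)
      (fin12.subset Set.subset_union_right),
    h.ncard_cross subset_rfl Set.sdiff_subset hC (by simp),
    h.ncard_cross Set.sdiff_subset subset_rfl hC (by simp)]
  · congr 1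
    split_ifs with hw
    · rw [← ncard_image2_append (fun l hl => hl.1)]
      · congr 1
        ext l
        exact ⟨fun hh => hh.2, fun hh => ⟨hw, hh⟩⟩
      · exact fun l hl m hm => Ham.simple_append hl hm h.ab
    · exact (congrArg Set.ncard
        (Set.eq_empty_of_forall_notMem fun l hh => hw hh.1)).trans (Set.ncard_empty _)
  · rw [Set.disjoint_right]
    rintro l ⟨-, hl⟩ (hl' | hl')
    · exact h.not_cross_of_direct subset_rfl Set.sdiff_subset hC (by simp) hl hl'
    · exact h.not_cross_of_direct Set.sdiff_subset subset_rfl hC (by simp) hl hl'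

/-- Routes `x ⤳ p ⤳ r ⤳ q ⤳ w` crossing the second and third pieces completely. -/
def Return (EA EB EC : Set (Sym2 α)) (VA VB VC : Set α) (p q r x w : α) : Set (List α) :=
  (fun t : (List α × List α) × (List α × List α) => t.1.1 ++ (t.2.1 ++ (t.2.2 ++ t.1.2))) ''
    (Ham2 EA x p q w VA ×ˢ (Ham EB p r VB ×ˢ Ham EC r q VC))

theorem Glued.simple_return (h : Glued E EA EB EC VA VB VC p q r) {x w : α}
    {l₁ l₃ l₅ l₆ : List α} (h1 : (l₁, l₆) ∈ Ham2 EA x p q w VA) (h3 : l₃ ∈ Ham EB p r VB)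
    (h5 : l₅ ∈ Ham EC r q VC) :
    Simple x (l₁ ++ (l₃ ++ (l₅ ++ l₆))) ∧ ∀ a, a ∈ Supp x (l₁ ++ (l₃ ++ (l₅ ++ l₆))) ↔
      a ∈ VA ∪ VB ∪ VC := by
  obtain ⟨r1, r6, n1, n6, s16, s⟩ := h1
  obtain ⟨r3, n3, s3⟩ := h3
  obtain ⟨r5, n5, s5⟩ := h5
  dsimp only at r1 r6 n1 n6 s16 s
  simp only [r1.nodup_append_iff, r3.nodup_append_iff, r5.nodup_append_iff, r1.mem_append_iff,
    r3.mem_append_iff, r5.mem_append_iff, s3, s5, Set.mem_union]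
  have := h.ab
  have := h.ac
  have := h.bc
  have := start_mem_supp q l₆
  have := r1.end_mem_supp
  grind

theorem Glued.mem_return_of_leaves (h : Glued E EA EB EC VA VB VC p q r) {x z w : α}
    (hx : x ∈ VA) (hw : w ∈ VA)
    (hz : z ∈ VC) (hzq : z ≠ q) (hzr : z ≠ r) {l : List α} (hn : Simple x l)
    (hs : ∀ a, a ∈ Supp x l ↔ a ∈ VA ∪ VB ∪ VC) (hl : Leaves EA EB EC p q r x l w) :
    l ∈ Return EA EB EC VA VB VC p q r x w := by
  obtain ⟨edge, memA, memB, memC, ab, ac, bc, pA, pB, qA, qC, rB, rC, pq, pr, qr⟩ := id h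
  simp only [Set.mem_union] at hs
  obtain ⟨l₁, l₂, rfl, h1, h2⟩ := hl
  have u1 := h1.supp_subset memA hx
  rcases h2 with h2 | ⟨l₃, l₄, rfl, h3, h4⟩
  · have u2 := h2.supp_subset memB pB
    simp only [h1.mem_append_iff] at hs
    grind
  have h4' : ∃ l₅ l₆, l₄ = l₅ ++ l₆ ∧ IsRoute EC r l₅ q ∧ IsRoute EA q l₆ w := by
    rcases h4 with h4 | h4
    · obtain rfl := ac w hw (h4.supp_subset memC rC _ h4.end_mem_supp)
      exact ⟨l₄, [], by simp, h4, rfl⟩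
    · exact h4
  obtain ⟨l₅, l₆, rfl, h5, h6⟩ := h4'
  have u3 := h3.supp_subset memB pB
  have u5 := h5.supp_subset memC rC
  have u6 := h6.supp_subset memA qA
  simp only [h1.nodup_append_iff, h3.nodup_append_iff, h5.nodup_append_iff,
    h3.mem_append_iff, h5.mem_append_iff] at hn
  simp only [h1.mem_append_iff, h3.mem_append_iff, h5.mem_append_iff] at hs
  have := h1.end_mem_supp
  have := h3.end_mem_supp
  have := h5.end_mem_supp
  have := start_mem_supp p l₃
  have := start_mem_supp r l₅
  have := start_mem_supp q l₆
  refine ⟨((l₁, l₆), (l₃, l₅)), ⟨⟨h1, h6, hn.1, hn.2.1.2.1.2.1, ?_, ?_⟩,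
    ⟨h3, hn.2.1.1, ?_⟩, ⟨h5, hn.2.1.2.1.1, ?_⟩⟩, rfl⟩ <;> dsimp only <;> grind

theorem Glued.mem_ham_of_return (h : Glued E EA EB EC VA VB VC p q r) {x w : α}
    {l : List α} (hl : l ∈ Return EA EB EC VA VB VC p q r x w) :
    l ∈ Ham E x w (VA ∪ VB ∪ VC) := by
  obtain ⟨⟨⟨l₁, l₆⟩, ⟨l₃, l₅⟩⟩, ⟨k1, k3, k5⟩, rfl⟩ := hl
  refine ⟨?_, h.simple_return k1 k3 k5⟩
  exact (k1.1.mono fun e he => (h.edge e).2 (.inl he)).append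
    ((k3.1.mono fun e he => (h.edge e).2 (.inr (.inl he))).append
      ((k5.1.mono fun e he => (h.edge e).2 (.inr (.inr he))).append
        (k1.2.1.mono fun e he => (h.edge e).2 (.inl he))))

theorem Glued.ncard_return (h : Glued E EA EB EC VA VB VC p q r) {x w : α} :
    (Return EA EB EC VA VB VC p q r x w).ncard = (Ham2 EA x p q w VA).ncard *
      ((Ham EB p r VB).ncard * (Ham EC r q VC).ncard) := by
  rw [Return, Set.InjOn.ncard_image, Set.ncard_prod, Set.ncard_prod]
  rintro ⟨⟨l₁, l₆⟩, ⟨l₃, l₅⟩⟩ ⟨k1, k3, k5⟩ ⟨⟨m₁, m₆⟩, ⟨m₃, m₅⟩⟩ ⟨j1, j3, j5⟩ he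
  dsimp only at k1 k3 k5 j1 j3 j5 he
  have hn := (h.simple_return k1 k3 k5).1
  have r1 : IsRoute EA x l₁ p := k1.1
  have r1' : IsRoute EA x m₁ p := j1.1
  obtain ⟨e1, he2⟩ := r1.split_unique r1' hn he
  have hn2 := (r1.nodup_append_iff.1 hn).2.1
  obtain ⟨e3, he4⟩ := k3.1.split_unique j3.1 hn2 he2
  have hn4 := (k3.1.nodup_append_iff.1 hn2).2.1
  obtain ⟨e5, e6⟩ := k5.1.split_unique j5.1 hn4 he4
  rw [e1, e3, e5, e6]

theorem Glued.disjoint_return (h : Glued E EA EB EC VA VB VC p q r) {x w : α} :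
    Disjoint (Return EA EB EC VA VB VC p q r x w) (Return EA EC EB VA VC VB q p r x w) := by
  rw [Set.disjoint_left]
  rintro _ ⟨⟨⟨l₁, l₆⟩, ⟨l₃, l₅⟩⟩, ⟨k1, k3, k5⟩, rfl⟩ ⟨⟨⟨m₁, m₆⟩, ⟨m₃, m₅⟩⟩, ⟨j1, j3, j5⟩, he⟩
  dsimp only at k1 k3 k5 j1 j3 j5 he
  have hn := (h.simple_return k1 k3 k5).1
  have hn' := (h.flip.simple_return j1 j3 j5).1
  have q5 := k5.1.end_mem_of_ne_nil (by rintro rfl; exact h.qr k5.1.symm)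
  have p5 := j5.1.end_mem_of_ne_nil (by rintro rfl; exact h.pr j5.1.symm)
  rcases List.append_eq_append_iff.1 he with ⟨t, h1, h2⟩ | ⟨t, h1, h2⟩
  · have hq := j1.1.end_mem
    dsimp only at hq
    simp only [Simple] at hn
    grind
  · have hp := k1.1.end_mem
    dsimp only at hp
    simp only [Simple] at hn'
    grind

theorem Glued.ncard_ham_return (h : Glued E EA EB EC VA VB VC p q r) {x y z w : α}
    (hx : x ∈ VA) (hw : w ∈ VA) (hy : y ∈ VB) (hyp : y ≠ p) (hyr : y ≠ r)
    (hz : z ∈ VC) (hzq : z ≠ q) (hzr : z ≠ r) (fA : VA.Finite) (fB : VB.Finite)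
    (fC : VC.Finite) :
    (Ham E x w (VA ∪ VB ∪ VC)).ncard =
      (Ham2 EA x p q w VA).ncard * ((Ham EB p r VB).ncard * (Ham EC r q VC).ncard) +
      (Ham2 EA x q p w VA).ncard * ((Ham EC q r VC).ncard * (Ham EB r p VB).ncard) := by
  have hcomm : VA ∪ VC ∪ VB = VA ∪ VB ∪ VC := Set.union_right_comm _ _ _
  have heq : Ham E x w (VA ∪ VB ∪ VC) =
      Return EA EB EC VA VB VC p q r x w ∪ Return EA EC EB VA VC VB q p r x w := by
    apply Set.Subset.antisymm
    · rintro l ⟨hl, hn, hs⟩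
      rcases h.cases hl hn hx with h1 | h1 | h1
      · have := h.ab y (h1.supp_subset h.memA hx y ((hs y).2 (.inl (.inr hy)))) hy
        contradiction
      · exact .inl (h.mem_return_of_leaves hx hw hz hzq hzr hn hs h1)
      · exact .inr (h.flip.mem_return_of_leaves hx hw hy hyp hyr hn
          (hcomm ▸ hs) h1)
    · rintro l (hl | hl)
      · exact h.mem_ham_of_return hl
      · exact hcomm ▸ h.flip.mem_ham_of_return hl
  have fin : (Ham E x w (VA ∪ VB ∪ VC)).Finite := finite_ham ((fA.union fB).union fC)
  rw [heq] at fin ⊢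
  rw [Set.ncard_union_eq h.disjoint_return (fin.subset Set.subset_union_left)
    (fin.subset Set.subset_union_right), h.ncard_return, h.flip.ncard_return]

theorem Glued.ham_meet_eq_empty (h : Glued E EA EB EC VA VB VC p q r) {x y z : α}
    (hx : x ∈ VA) (hy : y ∈ VB) (hyp : y ≠ p) (hyr : y ≠ r)
    (hz : z ∈ VC) (hzq : z ≠ q) (hzr : z ≠ r) :
    Ham E x r (VA ∪ VB ∪ VC) = ∅ := by
  have key : ∀ {EB EC : Set (Sym2 α)} {VB VC : Set α} {p q z : α} {l : List α},
      Glued E EA EB EC VA VB VC p q r → Simple x l → z ∈ VC → z ≠ q → z ≠ r → z ∈ Supp x l →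
      ¬ Leaves EA EB EC p q r x l r := by
    rintro EB EC VB VC p q z l h hn hz hzq hzr hs ⟨l₁, l₂, rfl, h1, h2⟩
    have hrA : r ∉ VA := fun hh => h.pr (h.ab r hh h.rB).symm
    have u1 := h1.supp_subset h.memA hx
    rw [h1.mem_append_iff] at hs
    have h3 : IsRoute EB p l₂ r := by
      rcases h2 with h2 | ⟨l₃, l₄, rfl, h3, h4 | ⟨l₅, l₆, rfl, h5, h6⟩⟩
      · exact h2
      · obtain rfl := h4.eq_nil
          (h3.nodup_append_iff.1 (h1.nodup_append_iff.1 hn).2.1).2.1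
        simpa using h3
      · exact absurd (h6.supp_subset h.memA h.qA _ h6.end_mem_supp) hrA
    rcases hs with hs | hs
    · exact hzq (h.ac z (u1 z hs) hz)
    · exact hzr (h.bc z (h3.supp_subset h.memB h.pB z hs) hz)
  refine Set.eq_empty_of_forall_notMem ?_
  rintro l ⟨hl, hn, hs⟩
  rcases h.cases hl hn hx with h1 | h1 | h1
  · exact h.pr (h.ab r (h1.supp_subset h.memA hx _ h1.end_mem_supp) h.rB).symm
  · exact key h hn hz hzq hzr ((hs z).2 (.inr hz)) h1
  · exact key h.flip hn hy hyp hyr ((hs y).2 (.inl (.inr hy))) h1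

/-- A simple route from the first piece to the second either passes from one to the other
directly, or uses both other gluing vertices. -/
theorem Glued.route_across (h : Glued E EA EB EC VA VB VC p q r) {x y : α} {l : List α}
    (hx : x ∈ VA) (hy : y ∈ VB) (hyp : y ≠ p) (hyr : y ≠ r) (hl : IsRoute E x l y)
    (hn : Simple x l) :
    (∃ l₁ l₂, l = l₁ ++ l₂ ∧ IsRoute EA x l₁ p ∧ IsRoute EB p l₂ y) ∨
      (q ∈ Supp x l ∧ r ∈ Supp x l) := by
  have hyA : y ∉ VA := fun hh => hyp (h.ab y hh hy)
  have hyC : y ∉ VC := fun hh => hyr (h.bc y hy hh)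
  rcases h.cases hl hn hx with h1 | ⟨l₁, l₂, rfl, h1, h2⟩ | ⟨l₁, l₂, rfl, h1, h2⟩
  · exact absurd (h1.supp_subset h.memA hx _ h1.end_mem_supp) hyA
  · rcases h2 with h2 | ⟨l₃, l₄, rfl, h3, h4 | ⟨l₅, l₆, rfl, h5, h6⟩⟩
    · exact .inl ⟨l₁, l₂, rfl, h1, h2⟩
    · exact absurd (h4.supp_subset h.memC h.rC _ h4.end_mem_supp) hyC
    · exact absurd (h6.supp_subset h.memA h.qA _ h6.end_mem_supp) hyA
  · rcases h2 with h2 | ⟨l₃, l₄, rfl, h3, h4⟩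
    · exact absurd (h2.supp_subset h.memC h.qC _ h2.end_mem_supp) hyC
    · refine .inr ⟨?_, ?_⟩ <;> simp only [h1.mem_append_iff, h3.mem_append_iff]
      · exact .inl h1.end_mem_supp
      · exact .inr (.inl h3.end_mem_supp)

/-- A simple route avoiding `p` from the third piece to the first goes through `q`. -/
theorem Glued.route_back (h : Glued E EA EB EC VA VB VC p q r) {z w : α} {l : List α}
    (hz : z ∈ VC) (hw : w ∈ VA) (hl : IsRoute E z l w) (hn : Simple z l)
    (hp : p ∉ Supp z l) :
    ∃ l₁ l₂, l = l₁ ++ l₂ ∧ IsRoute EC z l₁ q ∧ IsRoute EA q l₂ w := by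
  rcases h.rot.rot.cases hl hn hz with h1 | ⟨l₁, l₂, rfl, h1, h2⟩ | ⟨l₁, l₂, rfl, h1, h2⟩
  · obtain rfl := h.ac w hw (h1.supp_subset h.memC hz _ h1.end_mem_supp)
    exact ⟨l, [], by simp, h1, rfl⟩
  · rcases h2 with h2 | ⟨l₃, l₄, rfl, h3, h4⟩
    · exact ⟨l₁, l₂, rfl, h1, h2⟩
    · simp only [h1.mem_append_iff, h3.mem_append_iff] at hp
      exact absurd (.inr (.inl h3.end_mem_supp)) hp
  · rcases h2 with h2 | ⟨l₃, l₄, rfl, h3, h4⟩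
    · have := h.ab w hw (h2.supp_subset h.memB h.rB _ h2.end_mem_supp)
      subst this
      rw [h1.mem_append_iff] at hp
      exact absurd (.inr h2.end_mem_supp) hp
    · simp only [h1.mem_append_iff, h3.mem_append_iff] at hp
      exact absurd (.inr (.inl h3.end_mem_supp)) hp

/-- A simple route avoiding `p` from the third piece to `r` stays in the third piece. -/
theorem Glued.route_to_meet (h : Glued E EA EB EC VA VB VC p q r) {z : α} {l : List α}
    (hz : z ∈ VC) (hl : IsRoute E z l r) (hn : Simple z l)
    (hp : p ∉ Supp z l) : IsRoute EC z l r := by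
  have hrA : r ∉ VA := fun hh => h.pr (h.ab r hh h.rB).symm
  rcases h.rot.rot.cases hl hn hz with h1 | ⟨l₁, l₂, rfl, h1, h2⟩ | ⟨l₁, l₂, rfl, h1, h2⟩
  · exact h1
  · rcases h2 with h2 | ⟨l₃, l₄, rfl, h3, h4⟩
    · exact absurd (h2.supp_subset h.memA h.qA _ h2.end_mem_supp) hrA
    · simp only [h1.mem_append_iff, h3.mem_append_iff] at hp
      exact absurd (.inr (.inl h3.end_mem_supp)) hp
  · rcases h2 with h2 | ⟨l₃, l₄, rfl, h3, h4⟩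
    · obtain rfl := h2.eq_nil (h1.nodup_append_iff.1 hn).2.1
      simpa using h1
    · simp only [h1.mem_append_iff, h3.mem_append_iff] at hp
      exact absurd (.inr (.inl h3.end_mem_supp)) hp

theorem Ham.disjoint {E E' : Set (Sym2 α)} {u v u' v' : α} {W W' : Set α} (hW : W ≠ W')
    (hu : u = u') : Disjoint (Ham E u v W) (Ham E' u' v' W') := by
  subst hu
  rw [Set.disjoint_left]
  rintro l ⟨_, _, h⟩ ⟨_, _, h'⟩
  exact hW (Set.ext fun a => (h a).symm.trans (h' a))

theorem Glued.ncard_ham2_back (h : Glued E EA EB EC VA VB VC p q r) {x y z w : α}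
    (hx : x ∈ VA) (hw : w ∈ VA) (hy : y ∈ VB) (hyp : y ≠ p) (hyr : y ≠ r)
    (hz : z ∈ VC) (fB : VB.Finite) (fC : VC.Finite) :
    (Ham2 E x y z w (VA ∪ VB ∪ VC)).ncard = (Ham2 EA x p q w VA).ncard *
      ((Ham EB p y VB).ncard * (Ham EC z q (VC \ {r})).ncard +
        (Ham EB p y (VB \ {r})).ncard * (Ham EC z q VC).ncard) := by
  obtain ⟨edge, memA, memB, memC, ab, ac, bc, pA, pB, qA, qC, rB, rC, pq, pr, qr⟩ := id h
  have hA : ∀ e ∈ EA, e ∈ E := fun e he => (edge e).2 (.inl he)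
  have hB : ∀ e ∈ EB, e ∈ E := fun e he => (edge e).2 (.inr (.inl he))
  have hC : ∀ e ∈ EC, e ∈ E := fun e he => (edge e).2 (.inr (.inr he))
  have eB (a : α) : a ∈ VB \ {r} ↔ a ∈ VB ∧ a ≠ r := Iff.rfl
  have eC (a : α) : a ∈ VC \ {r} ↔ a ∈ VC ∧ a ≠ r := Iff.rfl
  have heq : Ham2 E x y z w (VA ∪ VB ∪ VC) =
      (fun t : (List α × List α) × (List α × List α) => (t.1.1 ++ t.2.1, t.2.2 ++ t.1.2)) ''
        (Ham2 EA x p q w VA ×ˢ ((Ham EB p y VB ×ˢ Ham EC z q (VC \ {r})) ∪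
          (Ham EB p y (VB \ {r}) ×ˢ Ham EC z q VC))) := by
    apply Set.Subset.antisymm
    · rintro ⟨l, m⟩ ⟨k1, k2, n1, n2, hd, hs⟩
      dsimp only at k1 k2 n1 n2 hd hs
      have hback : p ∉ Supp z m → _ := h.route_back hz hw k2 n2
      rcases h.route_across hx hy hyp hyr k1 n1 with ⟨l₁, l₂, rfl, h1, h2⟩ | ⟨hq, hr⟩
      · have hp : p ∈ Supp x (l₁ ++ l₂) := (h1.mem_append_iff p).2 (.inl h1.end_mem_supp)
        obtain ⟨m₁, m₂, rfl, h3, h4⟩ := hback (hd p hp)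
        have u1 := h1.supp_subset memA hx
        have u2 := h2.supp_subset memB pB
        have u3 := h3.supp_subset memC hz
        have u4 := h4.supp_subset memA qA
        simp only [h1.nodup_append_iff] at n1
        simp only [h3.nodup_append_iff] at n2
        simp only [h1.mem_append_iff, h3.mem_append_iff, Set.mem_union] at hd hs
        have := h1.end_mem_supp
        have := h3.end_mem_supp
        have := start_mem_supp p l₂
        have := start_mem_supp q m₂
        by_cases hr : r ∈ Supp p l₂
        · refine ⟨((l₁, m₂), (l₂, m₁)), ⟨⟨h1, h4, n1.1, n2.2.1, ?_, ?_⟩,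
            .inl ⟨⟨h2, n1.2.1, ?_⟩, ⟨h3, n2.1, ?_⟩⟩⟩, rfl⟩ <;> dsimp only <;> grind
        · refine ⟨((l₁, m₂), (l₂, m₁)), ⟨⟨h1, h4, n1.1, n2.2.1, ?_, ?_⟩,
            .inr ⟨⟨h2, n1.2.1, ?_⟩, ⟨h3, n2.1, ?_⟩⟩⟩, rfl⟩ <;> dsimp only <;> grind
      · have hq' := hd q hq
        exfalso
        rcases h.rot.rot.flip.exit k2 hz with h1 | ⟨m₁, m₂, rfl, h1, h2⟩ |
          ⟨m₁, m₂, rfl, h1, h2⟩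
        · obtain rfl := ac w hw (h1.supp_subset memC hz _ h1.end_mem_supp)
          exact hq' h1.end_mem_supp
        · exact hd r hr ((h1.mem_append_iff r).2 (.inl h1.end_mem_supp))
        · exact hq' ((h1.mem_append_iff q).2 (.inl h1.end_mem_supp))
    · rintro _ ⟨⟨⟨l₁, m₂⟩, ⟨l₂, m₁⟩⟩, ⟨k, hk⟩, rfl⟩
      obtain ⟨r1, r4, n1, n4, hd, hs⟩ := k
      dsimp only at r1 r4 n1 n4 hd hs hk ⊢
      have := r1.end_mem_supp
      have := start_mem_supp q m₂
      obtain ⟨⟨r2, n2, s2⟩, ⟨r3, n3, s3⟩⟩ | ⟨⟨r2, n2, s2⟩, ⟨r3, n3, s3⟩⟩ := hk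
      all_goals
        dsimp only at r2 n2 s2 r3 n3 s3
        refine ⟨(r1.mono hA).append (r2.mono hB), (r3.mono hC).append (r4.mono hA), ?_⟩
        simp only [r1.nodup_append_iff, r3.nodup_append_iff, r1.mem_append_iff,
          r3.mem_append_iff, s2, s3, eB, eC, Set.mem_union]
        clear eB eC hA hB hC edge memA memB memC
        grind
  have fU := (finite_ham (E := EB) (u := p) (v := y) fB).prod
    (finite_ham (E := EC) (u := z) (v := q) (fC.subset (Set.sdiff_subset (t := {r}))))
  have fU' := (finite_ham (E := EB) (u := p) (v := y)
    (fB.subset (Set.sdiff_subset (t := {r})))).prod (finite_ham (E := EC) (u := z) (v := q) fC)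
  rw [heq, Set.InjOn.ncard_image, Set.ncard_prod, Set.ncard_union_eq ?_ fU fU',
    Set.ncard_prod, Set.ncard_prod]
  · refine Set.disjoint_prod.2 (.inl (Ham.disjoint ?_ rfl))
    intro hh
    have := (Set.ext_iff.1 hh r).1 rB
    exact this.2 rfl
  · rintro ⟨⟨l₁, m₂⟩, ⟨l₂, m₁⟩⟩ hk ⟨⟨l₁', m₂'⟩, ⟨l₂', m₁'⟩⟩ hk' he
    have hmem := (Set.ext_iff.1 heq _).2 ⟨_, hk, rfl⟩
    have h3 : IsRoute EC z m₁ q := by rcases hk.2 with h | h <;> exact h.2.1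
    have h3' : IsRoute EC z m₁' q := by rcases hk'.2 with h | h <;> exact h.2.1
    simp only [Prod.mk.injEq] at he
    obtain ⟨rfl, rfl⟩ := hk.1.1.split_unique hk'.1.1 hmem.2.2.1 he.1
    obtain ⟨rfl, rfl⟩ := h3.split_unique h3' hmem.2.2.2.1 he.2
    rfl

theorem Glued.ncard_ham2_meet (h : Glued E EA EB EC VA VB VC p q r) {x y z : α}
    (hx : x ∈ VA) (hy : y ∈ VB) (hyp : y ≠ p) (hyr : y ≠ r)
    (hz : z ∈ VC) (fA : VA.Finite) (fC : VC.Finite) :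
    (Ham2 E x y z r (VA ∪ VB ∪ VC)).ncard = (Ham EB p y (VB \ {r})).ncard *
      ((Ham EA x p VA).ncard * (Ham EC z r (VC \ {q})).ncard +
        (Ham EA x p (VA \ {q})).ncard * (Ham EC z r VC).ncard) := by
  obtain ⟨edge, memA, memB, memC, ab, ac, bc, pA, pB, qA, qC, rB, rC, pq, pr, qr⟩ := id h
  have hA : ∀ e ∈ EA, e ∈ E := fun e he => (edge e).2 (.inl he)
  have hB : ∀ e ∈ EB, e ∈ E := fun e he => (edge e).2 (.inr (.inl he))
  have hC : ∀ e ∈ EC, e ∈ E := fun e he => (edge e).2 (.inr (.inr he))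
  have eA (a : α) : a ∈ VA \ {q} ↔ a ∈ VA ∧ a ≠ q := Iff.rfl
  have eB (a : α) : a ∈ VB \ {r} ↔ a ∈ VB ∧ a ≠ r := Iff.rfl
  have eC (a : α) : a ∈ VC \ {q} ↔ a ∈ VC ∧ a ≠ q := Iff.rfl
  have heq : Ham2 E x y z r (VA ∪ VB ∪ VC) =
      (fun t : List α × (List α × List α) => (t.2.1 ++ t.1, t.2.2)) ''
        (Ham EB p y (VB \ {r}) ×ˢ ((Ham EA x p VA ×ˢ Ham EC z r (VC \ {q})) ∪
          (Ham EA x p (VA \ {q}) ×ˢ Ham EC z r VC))) := by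
    apply Set.Subset.antisymm
    · rintro ⟨l, m⟩ ⟨k1, k2, n1, n2, hd, hs⟩
      dsimp only at k1 k2 n1 n2 hd hs
      rcases h.route_across hx hy hyp hyr k1 n1 with ⟨l₁, l₂, rfl, h1, h2⟩ | ⟨hq, hr⟩
      · have hp : p ∈ Supp x (l₁ ++ l₂) := (h1.mem_append_iff p).2 (.inl h1.end_mem_supp)
        have h3 := h.route_to_meet hz k2 n2 (hd p hp)
        have u1 := h1.supp_subset memA hx
        have u2 := h2.supp_subset memB pB
        have u3 := h3.supp_subset memC hz
        simp only [h1.nodup_append_iff] at n1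
        simp only [h1.mem_append_iff, Set.mem_union] at hd hs
        have := h1.end_mem_supp
        have := h3.end_mem_supp
        have := start_mem_supp p l₂
        by_cases hq : q ∈ Supp x l₁
        · refine ⟨(l₂, (l₁, m)), ⟨⟨h2, n1.2.1, ?_⟩,
            .inl ⟨⟨h1, n1.1, ?_⟩, ⟨h3, n2, ?_⟩⟩⟩, rfl⟩ <;> grind
        · refine ⟨(l₂, (l₁, m)), ⟨⟨h2, n1.2.1, ?_⟩,
            .inr ⟨⟨h1, n1.1, ?_⟩, ⟨h3, n2, ?_⟩⟩⟩, rfl⟩ <;> grind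
      · exact absurd k2.end_mem_supp (hd r hr)
    · rintro _ ⟨⟨l₂, ⟨l₁, m⟩⟩, ⟨⟨r2, n2, s2⟩, hk⟩, rfl⟩
      dsimp only at r2 n2 s2 hk ⊢
      obtain ⟨⟨r1, n1, s1⟩, ⟨r3, n3, s3⟩⟩ | ⟨⟨r1, n1, s1⟩, ⟨r3, n3, s3⟩⟩ := hk
      all_goals
        dsimp only at r1 n1 s1 r3 n3 s3
        refine ⟨(r1.mono hA).append (r2.mono hB), r3.mono hC, ?_⟩
        simp only [r1.nodup_append_iff, r1.mem_append_iff, s1, s2, s3, Set.mem_union]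
        grind
  have fU := (finite_ham (E := EA) (u := x) (v := p) fA).prod
    (finite_ham (E := EC) (u := z) (v := r) (fC.subset (Set.sdiff_subset (t := {q}))))
  have fU' := (finite_ham (E := EA) (u := x) (v := p)
    (fA.subset (Set.sdiff_subset (t := {q})))).prod (finite_ham (E := EC) (u := z) (v := r) fC)
  rw [heq, Set.InjOn.ncard_image, Set.ncard_prod, Set.ncard_union_eq ?_ fU fU',
    Set.ncard_prod, Set.ncard_prod]
  · refine Set.disjoint_prod.2 (.inl (Ham.disjoint ?_ rfl))
    intro hh
    have := (Set.ext_iff.1 hh q).1 qA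
    exact this.2 rfl
  · rintro ⟨l₂, ⟨l₁, m⟩⟩ hk ⟨l₂', ⟨l₁', m'⟩⟩ hk' he
    have hmem := (Set.ext_iff.1 heq _).2 ⟨_, hk, rfl⟩
    have h1 : IsRoute EA x l₁ p := by rcases hk.2 with h | h <;> exact h.1.1
    have h1' : IsRoute EA x l₁' p := by rcases hk'.2 with h | h <;> exact h.1.1
    simp only [Prod.mk.injEq] at he
    obtain ⟨rfl, rfl⟩ := h1.split_unique h1' hmem.2.2.1 he.1
    obtain rfl := he.2
    rfl

theorem ham2_collide {E : Set (Sym2 α)} {x y z : α} {W : Set α} : Ham2 E x y z y W = ∅ :=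
  Set.eq_empty_of_forall_notMem fun _ ⟨h1, h2, _, _, h5, _⟩ =>
    h5 y h1.end_mem_supp h2.end_mem_supp

theorem ncard_ham2_self {E : Set (Sym2 α)} {x y z : α} {W : Set α} (hz : z ∈ W) :
    (Ham2 E x y z z W).ncard = (Ham E x y (W \ {z})).ncard := by
  have e (a : α) : a ∈ W \ {z} ↔ a ∈ W ∧ a ≠ z := Iff.rfl
  have : Ham2 E x y z z W = (fun l => (l, [])) '' Ham E x y (W \ {z}) := by
    apply Set.Subset.antisymm
    · rintro ⟨l, m⟩ ⟨h1, h2, h3, h4, h5, h6⟩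
      dsimp only at h1 h2 h3 h4 h5 h6
      obtain rfl := h2.eq_nil h4
      simp only [mem_supp_nil] at h5 h6
      refine ⟨l, ⟨h1, h3, ?_⟩, rfl⟩
      grind
    · rintro _ ⟨l, ⟨h1, h2, h3⟩, rfl⟩
      refine ⟨h1, rfl, h2, simple_nil z, ?_, ?_⟩ <;> simp only [mem_supp_nil, h3] <;> grind
  rw [this, Set.ncard_image_of_injective]
  exact fun l m h => (Prod.mk.inj h).1

end Routes

section Gasket

variable {α : Type*}

/-- Abstract Sierpinski gaskets of level `n` with vertex set `V`, edge set `E` and outmost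
vertices `x`, `y`, `z`. -/
inductive Gasket : ℕ → Set α → Set (Sym2 α) → α → α → α → Prop
  | zero {x y z : α} (hxy : x ≠ y) (hxz : x ≠ z) (hyz : y ≠ z) :
      Gasket 0 {x, y, z} {s(x, y), s(x, z), s(y, z)} x y z
  | succ {n : ℕ} {VA VB VC : Set α} {EA EB EC : Set (Sym2 α)} {x y z p q r : α}
      (hA : Gasket n VA EA x p q) (hB : Gasket n VB EB p y r) (hC : Gasket n VC EC q r z)
      (ab : ∀ a, a ∈ VA → a ∈ VB → a = p) (ac : ∀ a, a ∈ VA → a ∈ VC → a = q)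
      (bc : ∀ a, a ∈ VB → a ∈ VC → a = r) :
      Gasket (n + 1) (VA ∪ VB ∪ VC) (EA ∪ EB ∪ EC) x y z

variable {n : ℕ} {V : Set α} {E : Set (Sym2 α)} {x y z : α}

theorem Gasket.swap (h : Gasket n V E x y z) : Gasket n V E x z y := by
  induction h with
  | @zero x y z hxy hxz hyz =>
    have h1 : ({x, y, z} : Set α) = {x, z, y} := by grind
    have h2 : ({s(x, y), s(x, z), s(y, z)} : Set (Sym2 α)) = {s(x, z), s(x, y), s(z, y)} := by
      rw [Sym2.eq_swap (a := y) (b := z), Set.insert_comm]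
    rw [h1, h2]
    exact .zero hxz hxy hyz.symm
  | @succ n VA VB VC EA EB EC x y z p q r hA hB hC ab ac bc iA iB iC =>
    rw [Set.union_right_comm VA VB VC, Set.union_right_comm EA EB EC]
    exact .succ iA iC iB ac ab (fun a h1 h2 => bc a h2 h1)

theorem Gasket.rot (h : Gasket n V E x y z) : Gasket n V E y z x := by
  induction h with
  | @zero x y z hxy hxz hyz =>
    have h1 : ({x, y, z} : Set α) = {y, z, x} := by grind
    have h2 : ({s(x, y), s(x, z), s(y, z)} : Set (Sym2 α)) = {s(y, z), s(y, x), s(z, x)} := by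
      rw [Sym2.eq_swap (a := y) (b := x), Sym2.eq_swap (a := z) (b := x)]; grind
    rw [h1, h2]
    exact .zero hyz hxy.symm hxz.symm
  | @succ n VA VB VC EA EB EC x y z p q r hA hB hC ab ac bc iA iB iC =>
    have h1 : VA ∪ VB ∪ VC = VB ∪ VC ∪ VA := by grind
    have h2 : EA ∪ EB ∪ EC = EB ∪ EC ∪ EA := by grind
    rw [h1, h2]
    exact .succ iB iC iA bc (fun a h1 h2 => ab a h2 h1) (fun a h1 h2 => ac a h2 h1)

theorem Gasket.mem_left (h : Gasket n V E x y z) : x ∈ V := by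
  induction h with
  | zero => simp
  | succ hA hB hC ab ac bc iA iB iC => exact .inl (.inl iA)

theorem Gasket.mem_edge (h : Gasket n V E x y z) : ∀ u v, s(u, v) ∈ E → u ∈ V := by
  induction h with
  | zero => intro u v; simp; grind
  | succ hA hB hC ab ac bc iA iB iC =>
    rintro u v ((h | h) | h)
    · exact .inl (.inl (iA u v h))
    · exact .inl (.inr (iB u v h))
    · exact .inr (iC u v h)

theorem Gasket.finite (h : Gasket n V E x y z) : V.Finite := by
  induction h with
  | zero => exact Set.toFinite _
  | succ hA hB hC ab ac bc iA iB iC => exact (iA.union iB).union iC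

theorem Gasket.mem_mid (h : Gasket n V E x y z) : y ∈ V := h.rot.mem_left

theorem Gasket.mem_right (h : Gasket n V E x y z) : z ∈ V := h.rot.rot.mem_left

theorem Gasket.left_ne_mid (h : Gasket n V E x y z) : x ≠ y := by
  induction h with
  | zero hxy => exact hxy
  | succ hA hB hC ab ac bc iA iB iC =>
    rintro rfl
    exact iA (ab _ hA.mem_left hB.mem_mid)

theorem Gasket.left_ne_right (h : Gasket n V E x y z) : x ≠ z := h.swap.left_ne_mid

theorem Gasket.mid_ne_right (h : Gasket n V E x y z) : y ≠ z := h.rot.left_ne_mid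

theorem Glued.of_gasket {VA VB VC : Set α} {EA EB EC : Set (Sym2 α)} {p q r : α}
    (hA : Gasket n VA EA x p q) (hB : Gasket n VB EB p y r) (hC : Gasket n VC EC q r z)
    (ab : ∀ a, a ∈ VA → a ∈ VB → a = p) (ac : ∀ a, a ∈ VA → a ∈ VC → a = q)
    (bc : ∀ a, a ∈ VB → a ∈ VC → a = r) :
    Glued (EA ∪ EB ∪ EC) EA EB EC VA VB VC p q r where
  edge e := by simp only [Set.mem_union, or_assoc]
  memA := hA.mem_edge
  memB := hB.mem_edge
  memC := hC.mem_edge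
  ab := ab
  ac := ac
  bc := bc
  pA := hA.mem_mid
  pB := hB.mem_left
  qA := hA.mem_right
  qC := hC.mem_left
  rB := hB.mem_right
  rC := hC.mem_mid
  pq := hA.mid_ne_right
  pr := hB.left_ne_right
  qr := hC.left_ne_mid

theorem Gasket.exists_inner (h : Gasket (n + 1) V E x y z) :
    ∃ w ∈ V, w ≠ x ∧ w ≠ y ∧ w ≠ z := by
  cases h with
  | @succ n VA VB VC EA EB EC x y z p q r hA hB hC ab ac bc =>
    refine ⟨p, .inl (.inl hA.mem_mid), hA.left_ne_mid.symm, hB.left_ne_mid, ?_⟩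
    rintro rfl
    exact hC.left_ne_right (ac _ hA.mem_mid hC.mem_right).symm

mutual

/-- Number of Hamiltonian paths of a level-`n` gasket between two outmost vertices. -/
def hcount : ℕ → ℕ
  | 0 => 1
  | n + 1 => 2 * hcount n ^ 2 * gcount n

/-- Number of paths between two outmost vertices of a level-`n` gasket that visit every vertex
except the third outmost one. -/
def gcount : ℕ → ℕ
  | 0 => 1
  | n + 1 => 2 * hcount n * gcount n ^ 2 + if n = 0 then hcount n ^ 2 else 0

end

theorem ncard_ham_triangle (hxy : x ≠ y) (hxz : x ≠ z) (hyz : y ≠ z) :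
    (Ham {s(x, y), s(x, z), s(y, z)} x y {x, y, z}).ncard = 1 ∧
      (Ham {s(x, y), s(x, z), s(y, z)} x y ({x, y, z} \ {z})).ncard = 1 := by
  constructor
  · rw [Set.ncard_eq_one]
    refine ⟨[z, y], Set.ext fun l => ⟨?_, ?_⟩⟩
    · rintro ⟨h1, h2, h3⟩
      simp only [Supp, Simple, Set.mem_ofPred_eq, Set.mem_insert_iff, Set.mem_singleton_iff]
        at h2 h3
      match l, h1, h2, h3 with
      | [], h1, _, _ => exact absurd h1 hxy
      | [a], h1, _, h3 =>
        have h4 : a = y := h1.2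
        have := (h3 z).2
        simp_all [eq_comm]
      | [a, b], h1, h2, h3 =>
        have h4 : b = y := h1.2.2
        have := (h3 a).1
        clear h1 h3
        simp_all
        grind
      | a :: b :: c :: l, _, h2, h3 =>
        have := h3 a
        have := h3 b
        have := h3 c
        grind
    · rintro rfl
      refine ⟨⟨by simp, by simp [Sym2.eq_swap], rfl⟩, ?_, ?_⟩
      · simp only [Simple]; grind
      · intro a; simp only [Supp, Set.mem_ofPred_eq]; grind
  · rw [Set.ncard_eq_one]
    refine ⟨[y], Set.ext fun l => ⟨?_, ?_⟩⟩
    · rintro ⟨h1, h2, h3⟩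
      simp only [Supp, Simple, Set.mem_ofPred_eq, Set.mem_sdiff, Set.mem_insert_iff,
        Set.mem_singleton_iff] at h2 h3
      match l, h1, h2, h3 with
      | [], h1, _, _ => exact absurd h1 hxy
      | [a], h1, _, _ =>
        have h4 : a = y := h1.2
        rw [h4, Set.mem_singleton_iff]
      | a :: b :: l, _, h2, h3 =>
        have := h3 a
        have := h3 b
        grind
    · rintro rfl
      refine ⟨⟨by simp, rfl⟩, ?_, ?_⟩
      · simp only [Simple]; grind
      · intro a
        simp only [Supp, Set.mem_ofPred_eq, Set.mem_sdiff, Set.mem_insert_iff,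
          Set.mem_singleton_iff]
        grind

theorem Gasket.ncard_ham (h : Gasket n V E x y z) :
    (Ham E x y V).ncard = hcount n ∧ (Ham E x y (V \ {z})).ncard = gcount n := by
  induction n generalizing V E x y z with
  | zero =>
    cases h with
    | zero hxy hxz hyz => exact ncard_ham_triangle hxy hxz hyz
  | succ n ih =>
    cases h with
    | @succ n VA VB VC EA EB EC x y z p q r hA hB hC ab ac bc =>
      have hG := Glued.of_gasket hA hB hC ab ac bc
      have hzA : z ∉ VA := fun hz => hC.left_ne_right (ac _ hz hC.mem_right).symm
      have hzB : z ∉ VB := fun hz => hC.mid_ne_right (bc _ hz hC.mem_right).symm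
      have hdiff : (VA ∪ VB ∪ VC) \ {z} = VA ∪ VB ∪ (VC \ {z}) := by grind
      have key : ∀ WC, WC ⊆ VC → q ∈ WC → r ∈ WC → _ := fun WC h1 h2 h3 =>
        hG.ncard_ham_cross (x := x) (y := y) (WC := WC) hA.mem_left hB.mem_mid
          hB.left_ne_mid.symm hB.mid_ne_right h1 h2 h3
          hA.finite hB.finite hC.finite
      constructor
      · rw [key VC subset_rfl hC.mem_left hC.mem_mid, if_neg, (ih hA.swap).1, (ih hC).1,
          (ih hB.rot.rot.swap).2, (ih hA.swap).2, (ih hB.rot.rot.swap).1, hcount]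
        · ring
        · intro hh
          rcases hh z hC.mem_right with hz | hz
          · exact hC.left_ne_right hz.symm
          · exact hC.mid_ne_right hz.symm
      · rw [hdiff, key (VC \ {z}) Set.sdiff_subset ⟨hC.mem_left, hC.left_ne_right⟩
          ⟨hC.mem_mid, hC.mid_ne_right⟩, (ih hA.swap).1, (ih hC).2,
          (ih hB.rot.rot.swap).2, (ih hA.swap).2, (ih hB.rot.rot.swap).1, (ih hA).1, (ih hB).1,
          gcount]
        have : (∀ w ∈ VC \ {z}, w = q ∨ w = r) ↔ n = 0 := by
          constructor
          · intro hh
            by_contra hn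
            obtain ⟨m, rfl⟩ := Nat.exists_eq_succ_of_ne_zero hn
            obtain ⟨w, hw, h1, h2, h3⟩ := hC.exists_inner
            rcases hh w ⟨hw, h3⟩ with h | h <;> contradiction
          · rintro rfl
            cases hC
            rintro w ⟨h1, h2⟩
            simp only [Set.mem_insert_iff, Set.mem_singleton_iff] at h1 h2
            tauto
        simp only [this]
        split_ifs <;> ring

end Gasket

section Concrete

theorem Gasket.map {α β : Type*} {n : ℕ} {V : Set α} {E : Set (Sym2 α)} {x y z : α} (φ : α → β)
    (hφ : Function.Injective φ) (h : Gasket n V E x y z) :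
    Gasket n (φ '' V) (Sym2.map φ '' E) (φ x) (φ y) (φ z) := by
  induction h with
  | zero hxy hxz hyz =>
    simp only [Set.image_insert_eq, Set.image_singleton, Sym2.map_mk]
    exact .zero (hφ.ne hxy) (hφ.ne hxz) (hφ.ne hyz)
  | succ hA hB hC ab ac bc iA iB iC =>
    simp only [Set.image_union]
    refine .succ iA iB iC ?_ ?_ ?_
    · rintro _ ⟨u, hu, rfl⟩ ⟨v, hv, h⟩
      rw [hφ h] at hv
      rw [ab u hu hv]
    · rintro _ ⟨u, hu, rfl⟩ ⟨v, hv, h⟩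
      rw [hφ h] at hv
      rw [ac u hu hv]
    · rintro _ ⟨u, hu, rfl⟩ ⟨v, hv, h⟩
      rw [hφ h] at hv
      rw [bc u hu hv]

theorem sq3_pos : 0 < sq3 := Real.sqrt_pos.2 (by norm_num)

theorem region {n : ℕ} {v : ℝ × ℝ} (hv : v ∈ V n) :
    ∃ u t : ℝ, v = (u, t * sq3) ∧ 0 ≤ t ∧ t ≤ u ∧ t ≤ 2 ^ n - u := by
  induction n generalizing v with
  | zero =>
    rcases hv with rfl | rfl | rfl
    · exact ⟨0, 0, by simp [o]⟩
    · exact ⟨1, 0, by simp [a]⟩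
    · exact ⟨1 / 2, 1 / 2, by norm_num [b]⟩
  | succ n ih =>
    have h2 : (2 : ℝ) ^ (n + 1) = 2 * 2 ^ n := by ring
    have h0 : (0 : ℝ) < 2 ^ n := by positivity
    rcases hv with (hv | ⟨w, hw, rfl⟩) | ⟨w, hw, rfl⟩
    · obtain ⟨u, t, rfl, h3, h4, h5⟩ := ih hv
      exact ⟨u, t, rfl, h3, h4, by linarith⟩
    · obtain ⟨u, t, rfl, h3, h4, h5⟩ := ih hw
      exact ⟨u + 2 ^ n, t, by simp [a], h3, by linarith, by linarith⟩
    · obtain ⟨u, t, rfl, h3, h4, h5⟩ := ih hw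
      refine ⟨u + 2 ^ n / 2, t + 2 ^ n / 2, ?_, by linarith, by linarith, by linarith⟩
      simp only [b, Prod.mk_add_mk]
      ring_nf

theorem mul_sq3_inj {s t : ℝ} : s * sq3 = t * sq3 ↔ s = t :=
  mul_left_inj' sq3_pos.ne'

theorem o_add (t : ℝ × ℝ) : o + t = t := by simp [o]

theorem a_add_a (n : ℕ) : a n + a n = a (n + 1) := by
  simp only [a, Prod.mk_add_mk]; ring_nf

theorem b_add_b (n : ℕ) : b n + b n = b (n + 1) := by
  simp only [b, Prod.mk_add_mk]; ring_nf

theorem b_add_a (n : ℕ) : b n + a n = c n := by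
  simp only [a, b, c, Prod.mk_add_mk]; ring_nf

theorem a_add_b (n : ℕ) : a n + b n = c n := by rw [add_comm, b_add_a]

theorem meet_a {n : ℕ} {v : ℝ × ℝ} (h : v ∈ V n) (h' : v ∈ (· + a n) '' V n) : v = a n := by
  obtain ⟨w, hw, rfl⟩ := h'
  obtain ⟨u, t, rfl, h1, h2, h3⟩ := region hw
  obtain ⟨u', t', h4, h5, h6, h7⟩ := region h
  simp only [a, Prod.mk_add_mk, Prod.mk.injEq, add_zero, mul_sq3_inj] at h4 ⊢
  have : t = 0 := by linarith
  exact ⟨by linarith, by simp [this]⟩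

theorem meet_b {n : ℕ} {v : ℝ × ℝ} (h : v ∈ V n) (h' : v ∈ (· + b n) '' V n) : v = b n := by
  obtain ⟨w, hw, rfl⟩ := h'
  obtain ⟨u, t, rfl, h1, h2, h3⟩ := region hw
  obtain ⟨u', t', h4, h5, h6, h7⟩ := region h
  simp only [b, Prod.mk_add_mk, Prod.mk.injEq, ← add_mul, mul_sq3_inj] at h4 ⊢
  exact ⟨by linarith, by linarith⟩

theorem meet_c {n : ℕ} {v : ℝ × ℝ} (h : v ∈ (· + a n) '' V n) (h' : v ∈ (· + b n) '' V n) :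
    v = c n := by
  obtain ⟨w, hw, rfl⟩ := h'
  obtain ⟨w', hw', h⟩ := h
  obtain ⟨u, t, rfl, h1, h2, h3⟩ := region hw
  obtain ⟨u', t', rfl, h5, h6, h7⟩ := region hw'
  simp only [a, b, c, Prod.mk_add_mk, Prod.mk.injEq, add_zero, ← add_mul, mul_sq3_inj] at h ⊢
  exact ⟨by linarith, by linarith⟩

theorem gasket_level (n : ℕ) : Gasket n (V n) (E n) o (a n) (b n) := by
  induction n with
  | zero =>
    have := sq3_pos
    refine .zero ?_ ?_ ?_ <;> simp [o, a, b]
  | succ n ih =>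
    have iB := ih.map (· + a n) (add_left_injective _)
    have iC := ih.map (· + b n) (add_left_injective _)
    simp only [o_add, a_add_a, b_add_b, a_add_b, b_add_a] at iB iC
    exact .succ ih iB iC (fun _ => meet_a) (fun _ => meet_b) (fun _ => meet_c)

theorem gasket_right (n : ℕ) :
    Gasket n ((· + a n) '' V n) (Sym2.map (· + a n) '' E n) (a n) (a (n + 1)) (c n) := by
  have iB := (gasket_level n).map (· + a n) (add_left_injective _)
  simpa only [o_add, a_add_a, b_add_a] using iB

theorem gasket_top (n : ℕ) :
    Gasket n ((· + b n) '' V n) (Sym2.map (· + b n) '' E n) (b n) (c n) (b (n + 1)) := by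
  have iC := (gasket_level n).map (· + b n) (add_left_injective _)
  simpa only [o_add, b_add_b, a_add_b] using iC

theorem glued_level (n : ℕ) : Glued (E (n + 1)) (E n) (Sym2.map (· + a n) '' E n)
    (Sym2.map (· + b n) '' E n) (V n) ((· + a n) '' V n) ((· + b n) '' V n)
    (a n) (b n) (c n) :=
  .of_gasket (gasket_level n) (gasket_right n) (gasket_top n)
    (fun _ => meet_a) (fun _ => meet_b) (fun _ => meet_c)

/-- Number of Hamiltonian paths of `SG n` from `o` to `w`, as routes. -/
def hamTo (n : ℕ) (w : ℝ × ℝ) : ℕ := (Ham (E n) o w (V n)).ncard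

/-- Number of pairs of disjoint paths covering `SG n`, one joining `o` to one of `a n`, `b n`,
the other one joining the remaining one to `w`. -/
def splitTo (n : ℕ) (w : ℝ × ℝ) : ℕ :=
  (Ham2 (E n) o (a n) (b n) w (V n)).ncard + (Ham2 (E n) o (b n) (a n) w (V n)).ncard

theorem hamTo_a (n : ℕ) : hamTo n (a n) = hcount n := (gasket_level n).ncard_ham.1

theorem hamTo_b (n : ℕ) : hamTo n (b n) = hcount n := (gasket_level n).swap.ncard_ham.1

theorem splitTo_a (n : ℕ) : splitTo n (a n) = gcount n := by
  rw [splitTo, ham2_collide, ncard_ham2_self (gasket_level n).mem_mid,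
    (gasket_level n).swap.ncard_ham.2, Set.ncard_empty, zero_add]

theorem splitTo_b (n : ℕ) : splitTo n (b n) = gcount n := by
  rw [splitTo, ham2_collide, ncard_ham2_self (gasket_level n).mem_right,
    (gasket_level n).ncard_ham.2, Set.ncard_empty, add_zero]

theorem V_succ_flip (n : ℕ) : V n ∪ (· + b n) '' V n ∪ (· + a n) '' V n = V (n + 1) :=
  Set.union_right_comm _ _ _

theorem hamTo_succ {n : ℕ} {w : ℝ × ℝ} (hw : w ∈ V n) :
    hamTo (n + 1) w = hcount n ^ 2 * splitTo n w := by
  have hA := gasket_level n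
  have hB := gasket_right n
  have hC := gasket_top n
  rw [hamTo, V, (glued_level n).ncard_ham_return hA.mem_left hw hB.mem_mid
    hB.left_ne_mid.symm hB.mid_ne_right hC.mem_right hC.left_ne_right.symm
    hC.mid_ne_right.symm hA.finite hB.finite hC.finite, hB.swap.ncard_ham.1,
    hC.swap.rot.rot.ncard_ham.1, hC.ncard_ham.1, hB.rot.rot.ncard_ham.1, splitTo]
  ring

theorem splitTo_succ {n : ℕ} {w : ℝ × ℝ} (hw : w ∈ V n) :
    splitTo (n + 1) w = 2 * gcount n * hcount n * splitTo n w := by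
  have hA := gasket_level n
  have hB := gasket_right n
  have hC := gasket_top n
  have h1 := (glued_level n).ncard_ham2_back hA.mem_left hw hB.mem_mid
    hB.left_ne_mid.symm hB.mid_ne_right hC.mem_right hB.finite hC.finite
  have h2 := (glued_level n).flip.ncard_ham2_back hA.mem_left hw hC.mem_right
    hC.left_ne_right.symm hC.mid_ne_right.symm hB.mem_mid hC.finite hB.finite
  rw [V_succ_flip] at h2
  rw [splitTo, V, h1, ← V, h2, splitTo, hB.ncard_ham.1, hB.ncard_ham.2,
    hC.rot.rot.ncard_ham.1, hC.rot.rot.ncard_ham.2, hC.swap.ncard_ham.1, hC.swap.ncard_ham.2,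
    hB.swap.rot.rot.ncard_ham.1, hB.swap.rot.rot.ncard_ham.2]
  ring

theorem splitTo_c (n : ℕ) : splitTo (n + 1) (c n) = 4 * hcount n * gcount n ^ 2 := by
  have hA := gasket_level n
  have hB := gasket_right n
  have hC := gasket_top n
  have h1 := (glued_level n).ncard_ham2_meet hA.mem_left hB.mem_mid
    hB.left_ne_mid.symm hB.mid_ne_right hC.mem_right hA.finite hC.finite
  have h2 := (glued_level n).flip.ncard_ham2_meet hA.mem_left hC.mem_right
    hC.left_ne_right.symm hC.mid_ne_right.symm hB.mem_mid hA.finite hB.finite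
  rw [V_succ_flip] at h2
  rw [splitTo, V, h1, ← V, h2, hB.ncard_ham.2, hA.ncard_ham.1, hA.ncard_ham.2,
    hC.swap.rot.ncard_ham.1, hC.swap.rot.ncard_ham.2, hC.swap.ncard_ham.2,
    hA.swap.ncard_ham.1, hA.swap.ncard_ham.2, hB.rot.ncard_ham.1, hB.rot.ncard_ham.2]
  ring

theorem hamTo_c (n : ℕ) : hamTo (n + 1) (c n) = 0 := by
  have hA := gasket_level n
  have hB := gasket_right n
  have hC := gasket_top n
  rw [hamTo, V, (glued_level n).ham_meet_eq_empty hA.mem_left hB.mem_mid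
    hB.left_ne_mid.symm hB.mid_ne_right hC.mem_right hC.left_ne_right.symm
    hC.mid_ne_right.symm, Set.ncard_empty]

end Concrete

section Bridge

theorem exists_walk {α : Type*} {E : Set (Sym2 α)} {u v : α} {l : List α} (h : IsRoute E u l v)
    (hn : Simple u l) : ∃ p : (SimpleGraph.fromEdgeSet E).Walk u v, p.support = u :: l := by
  induction l generalizing u with
  | nil =>
    cases h
    exact ⟨.nil, rfl⟩
  | cons w l ih =>
    obtain ⟨h1, h2⟩ := List.nodup_cons.1 hn
    obtain ⟨p, hp⟩ := ih h.2 h2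
    have hadj : (SimpleGraph.fromEdgeSet E).Adj u w :=
      (SimpleGraph.fromEdgeSet_adj E).2 ⟨h.1, by grind⟩
    exact ⟨.cons hadj p, by simp [hp]⟩

theorem isRoute_of_walk {α : Type*} {E : Set (Sym2 α)} {u v : α}
    (p : (SimpleGraph.fromEdgeSet E).Walk u v) : IsRoute E u p.support.tail v := by
  induction p with
  | nil => rfl
  | @cons u v w h p ih =>
    have : (SimpleGraph.Walk.cons h p).support.tail = v :: p.support.tail := by simp
    rw [this]
    exact ⟨((SimpleGraph.fromEdgeSet_adj E).1 h).1, ih⟩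

theorem f_o_eq (n : ℕ) (w : ℝ × ℝ) : f n o w = hamTo n w := by
  have key : ∀ p : (G n).Walk o w, o :: p.support.tail = p.support := fun p =>
    p.cons_tail_support
  have hmem : ∀ p : {p : (G n).Walk o w // IsHamPath n p},
      p.1.support.tail ∈ Ham (E n) o w (V n) := by
    rintro ⟨p, hp, hs⟩
    refine ⟨isRoute_of_walk p, ?_, ?_⟩
    · rw [Simple, key]
      exact hp.support_nodup
    · rw [Supp, key]
      exact hs
  rw [f, hamTo, ← Nat.card_coe_set_eq]
  refine Nat.card_eq_of_bijective (fun p => ⟨_, hmem p⟩) ⟨?_, ?_⟩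
  · rintro ⟨p, hp⟩ ⟨p', hp'⟩ h
    have h1 : p.support.tail = p'.support.tail := congrArg Subtype.val h
    refine Subtype.ext (SimpleGraph.Walk.ext_support ?_)
    rw [← key p, h1]
    exact key p'
  · rintro ⟨l, h1, h2, h3⟩
    obtain ⟨p, hp⟩ : ∃ p : (G n).Walk o w, p.support = o :: l := exists_walk h1 h2
    refine ⟨⟨p, ?_, ?_⟩, ?_⟩
    · exact (SimpleGraph.Walk.isPath_def p).2 (hp ▸ h2)
    · rw [hp]
      exact h3
    · exact Subtype.ext (by simp only [hp, List.tail_cons])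

end Bridge

section CornerValues

theorem hcount_pos (n : ℕ) : 0 < hcount n ∧ 0 < gcount n := by
  induction n with
  | zero => simp [hcount, gcount]
  | succ n ih =>
    obtain ⟨h1, h2⟩ := ih
    rw [hcount, gcount]
    exact ⟨by positivity, by positivity⟩

theorem a_mem_V (n : ℕ) : a n ∈ V n := (gasket_level n).mem_mid

theorem b_mem_V (n : ℕ) : b n ∈ V n := (gasket_level n).mem_right

theorem c_mem_V (n : ℕ) : c n ∈ V (n + 1) :=
  .inl (.inr (gasket_right n).mem_right)

theorem V_mono {m n : ℕ} (h : m ≤ n) : V m ⊆ V n := by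
  induction n, h using Nat.le_induction with
  | base => exact subset_rfl
  | succ n _ ih => exact fun v hv => .inl (.inl (ih hv))

/-- Value of `F (n + 1)` on `V n`, in terms of pairs of paths. -/
theorem F_succ {n : ℕ} {w : ℝ × ℝ} (hw : w ∈ V n) :
    F (n + 1) w = splitTo n w / (2 * gcount n) := by
  obtain ⟨h1, h2⟩ := hcount_pos n
  rw [F, f1, f_o_eq, f_o_eq, hamTo_a, hamTo_succ hw, hcount]
  have : (0 : ℝ) < hcount n := by exact_mod_cast h1
  have : (0 : ℝ) < gcount n := by exact_mod_cast h2
  push_cast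
  field_simp

theorem F_a_top (n : ℕ) : F n (a n) = 1 := by
  have : (hcount n : ℝ) ≠ 0 := by exact_mod_cast (hcount_pos n).1.ne'
  rw [F, f1, f_o_eq, hamTo_a, div_self this]

theorem F_b_top (n : ℕ) : F n (b n) = 1 := by
  have : (hcount n : ℝ) ≠ 0 := by exact_mod_cast (hcount_pos n).1.ne'
  rw [F, f1, f_o_eq, f_o_eq, hamTo_a, hamTo_b, div_self this]

theorem F_c_top (n : ℕ) : F (n + 1) (c n) = 0 := by
  rw [F, f_o_eq, hamTo_c, Nat.cast_zero, zero_div]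

/-- From level two on, the value of `F` at an inner vertex does not depend on the level. -/
theorem F_stable {m n : ℕ} (hm : m ≠ 0) (hn : m ≤ n) {w : ℝ × ℝ} (hw : w ∈ V m) :
    F (n + 1) w = F (m + 1) w := by
  induction n, hn using Nat.le_induction with
  | base => rfl
  | succ n hn ih =>
    rw [← ih, F_succ (V_mono hn hw), F_succ (V_mono (hn.trans n.le_succ) hw),
      splitTo_succ (V_mono hn hw), gcount, if_neg (by omega)]
    have h1 : (0 : ℝ) < hcount n := by exact_mod_cast (hcount_pos n).1
    have h2 : (0 : ℝ) < gcount n := by exact_mod_cast (hcount_pos n).2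
    push_cast
    field_simp
    ring

theorem F_a {j n : ℕ} (hj : j ≠ 0) (hn : j < n) : F n (a j) = 1 / 2 := by
  obtain ⟨n, rfl⟩ := Nat.exists_eq_succ_of_ne_zero (by omega : n ≠ 0)
  rw [F_stable hj (by omega) (a_mem_V j), F_succ (a_mem_V j), splitTo_a]
  have h2 : (gcount j : ℝ) ≠ 0 := by exact_mod_cast (hcount_pos j).2.ne'
  field_simp

theorem F_b {j n : ℕ} (hj : j ≠ 0) (hn : j < n) : F n (b j) = 1 / 2 := by
  obtain ⟨n, rfl⟩ := Nat.exists_eq_succ_of_ne_zero (by omega : n ≠ 0)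
  rw [F_stable hj (by omega) (b_mem_V j), F_succ (b_mem_V j), splitTo_b]
  have h2 : (gcount j : ℝ) ≠ 0 := by exact_mod_cast (hcount_pos j).2.ne'
  field_simp

theorem F_c {j n : ℕ} (hj : j ≠ 0) (hn : j + 2 ≤ n) : F n (c j) = 1 := by
  obtain ⟨n, rfl⟩ := Nat.exists_eq_succ_of_ne_zero (by omega : n ≠ 0)
  rw [F_stable (m := j + 1) (by omega) (by omega) (c_mem_V j), F_succ (c_mem_V j), splitTo_c,
    gcount, if_neg hj]
  have h1 : (0 : ℝ) < hcount j := by exact_mod_cast (hcount_pos j).1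
  have h2 : (0 : ℝ) < gcount j := by exact_mod_cast (hcount_pos j).2
  push_cast
  field_simp
  ring

theorem F_a_zero {n : ℕ} (hn : 2 ≤ n) : F n (a 0) = 1 / 3 := by
  obtain ⟨n, rfl⟩ := Nat.exists_eq_succ_of_ne_zero (by omega : n ≠ 0)
  have h := a_mem_V 0
  rw [F_stable (m := 0 + 1) one_ne_zero (by omega) (V_mono (Nat.le_succ 0) h),
    F_succ (V_mono (Nat.le_succ 0) h), splitTo_succ h, splitTo_a]
  norm_num [gcount, hcount]

theorem F_b_zero {n : ℕ} (hn : 2 ≤ n) : F n (b 0) = 1 / 3 := by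
  obtain ⟨n, rfl⟩ := Nat.exists_eq_succ_of_ne_zero (by omega : n ≠ 0)
  have h := b_mem_V 0
  rw [F_stable (m := 0 + 1) one_ne_zero (by omega) (V_mono (Nat.le_succ 0) h),
    F_succ (V_mono (Nat.le_succ 0) h), splitTo_succ h, splitTo_b]
  norm_num [gcount, hcount]

theorem F_c_zero {n : ℕ} (hn : 2 ≤ n) : F n (c 0) = 2 / 3 := by
  obtain ⟨n, rfl⟩ := Nat.exists_eq_succ_of_ne_zero (by omega : n ≠ 0)
  have h := c_mem_V 0
  rw [F_stable (m := 0 + 1) one_ne_zero (by omega) h, F_succ h, splitTo_c]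
  norm_num [gcount, hcount]

theorem enorm_a (j : ℕ) : enorm (a j) = 2 ^ j := by
  rw [enorm, a, zero_pow two_ne_zero, add_zero, Real.sqrt_sq (by positivity)]

theorem enorm_b (j : ℕ) : enorm (b j) = 2 ^ j := by
  have h3 : sq3 ^ 2 = 3 := Real.sq_sqrt (by norm_num)
  have : ((2 : ℝ) ^ j / 2) ^ 2 + (2 ^ j / 2 * sq3) ^ 2 = (2 ^ j) ^ 2 := by
    rw [mul_pow, h3]; ring
  rw [enorm, b, this, Real.sqrt_sq (by positivity)]

theorem enorm_c (j : ℕ) : enorm (c j) = 2 ^ j * sq3 := by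
  have h3 : sq3 ^ 2 = 3 := Real.sq_sqrt (by norm_num)
  have h : (3 * (2 : ℝ) ^ j / 2) ^ 2 + (2 ^ j / 2 * sq3) ^ 2 = (2 ^ j * sq3) ^ 2 := by
    rw [mul_pow, mul_pow, h3]; ring
  have := sq3_pos
  rw [enorm, c, h, Real.sqrt_sq (by positivity)]

theorem two_pow_inj {i j : ℕ} (h : (2 : ℝ) ^ i = 2 ^ j) : i = j :=
  pow_right_injective₀ (by norm_num) (by norm_num) h

theorem sum_C (n : ℕ) (φ : ℝ × ℝ → ℝ) : ∑ x ∈ C n, φ x =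
    (∑ j ∈ Finset.range (n + 1), φ (a j) + ∑ j ∈ Finset.range (n + 1), φ (b j)) +
      ∑ j ∈ Finset.range n, φ (c j) := by
  have h0 (j : ℕ) : (0 : ℝ) < 2 ^ j := by positivity
  have hs := sq3_pos
  have ia : Function.Injective a := fun i j h => two_pow_inj (Prod.mk.inj h).1
  have ib : Function.Injective b := fun i j h => two_pow_inj (by
    have := (Prod.mk.inj h).1
    linarith)
  have ic : Function.Injective c := fun i j h => two_pow_inj (by
    have := (Prod.mk.inj h).1
    linarith)
  have hab (i j : ℕ) : a i ≠ b j := fun h => by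
    have := h0 j
    have := (Prod.mk.inj h).2
    have : 0 < (2 : ℝ) ^ j / 2 * sq3 := by positivity
    linarith
  have hac (i j : ℕ) : a i ≠ c j := fun h => by
    have := h0 j
    have := (Prod.mk.inj h).2
    have : 0 < (2 : ℝ) ^ j / 2 * sq3 := by positivity
    linarith
  have hbc (i j : ℕ) : b i ≠ c j := fun h => by
    have := h0 j
    have h1 := (Prod.mk.inj h).1
    have h2 := mul_sq3_inj.1 (Prod.mk.inj h).2
    linarith
  rw [C, Finset.sum_union, Finset.sum_union, Finset.sum_image ia.injOn,
    Finset.sum_image ib.injOn, Finset.sum_image ic.injOn]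
  · rw [Finset.disjoint_left]
    simp only [Finset.mem_image]
    rintro _ ⟨i, _, rfl⟩ ⟨j, _, h⟩
    exact hab i j h.symm
  · rw [Finset.disjoint_left]
    simp only [Finset.mem_union, Finset.mem_image]
    rintro _ (⟨i, _, rfl⟩ | ⟨i, _, rfl⟩) ⟨j, _, h⟩
    · exact hac i j h.symm
    · exact hbc i j h.symm

/-- Sums over the corner vertices of functions depending on the norm only. -/
theorem sum_corner {n : ℕ} (hn : 2 ≤ n) (φ : ℝ → ℝ) :
    ∑ x ∈ C n, φ (enorm x) * F n x = 2 * φ (2 ^ n) + 2 / 3 * (φ 1 + φ sq3) +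
      ∑ j ∈ Finset.range (n - 1), φ (2 ^ (j + 1)) +
      ∑ j ∈ Finset.range (n - 2), φ (2 ^ (j + 1) * sq3) := by
  obtain ⟨m, rfl⟩ := Nat.exists_eq_add_of_le' hn
  have hsum (ψ : ℕ → ℝ) : ∑ j ∈ Finset.range (m + 2 + 1), ψ j =
      (∑ j ∈ Finset.range (m + 1), ψ (j + 1) + ψ 0) + ψ (m + 2) := by
    rw [Finset.sum_range_succ, Finset.sum_range_succ']
  have hsum' (ψ : ℕ → ℝ) : ∑ j ∈ Finset.range (m + 2), ψ j =
      (∑ j ∈ Finset.range m, ψ (j + 1) + ψ 0) + ψ (m + 1) := by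
    rw [Finset.sum_range_succ, Finset.sum_range_succ']
  have ha : ∑ j ∈ Finset.range (m + 1), φ (2 ^ (j + 1)) * F (m + 2) (a (j + 1)) =
      ∑ j ∈ Finset.range (m + 1), φ (2 ^ (j + 1)) * (1 / 2) :=
    Finset.sum_congr rfl fun j hj => by
      rw [F_a (by omega) (by have := Finset.mem_range.1 hj; omega)]
  have hb : ∑ j ∈ Finset.range (m + 1), φ (2 ^ (j + 1)) * F (m + 2) (b (j + 1)) =
      ∑ j ∈ Finset.range (m + 1), φ (2 ^ (j + 1)) * (1 / 2) :=
    Finset.sum_congr rfl fun j hj => by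
      rw [F_b (by omega) (by have := Finset.mem_range.1 hj; omega)]
  have hc : ∑ j ∈ Finset.range m, φ (2 ^ (j + 1) * sq3) * F (m + 2) (c (j + 1)) =
      ∑ j ∈ Finset.range m, φ (2 ^ (j + 1) * sq3) :=
    Finset.sum_congr rfl fun j hj => by
      rw [F_c (by omega) (by have := Finset.mem_range.1 hj; omega), mul_one]
  rw [sum_C]
  simp only [enorm_a, enorm_b, enorm_c]
  rw [hsum, hsum, hsum', ha, hb, hc, F_a_top, F_b_top, F_c_top, F_a_zero hn, F_b_zero hn,
    F_c_zero hn, ← Finset.sum_mul]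
  simp only [pow_zero, one_mul, Nat.add_sub_cancel, show m + 2 - 1 = m + 1 by omega]
  ring

end CornerValues

/-- exact formula for the mean `ℓ` displacement over the corner
vertices. -/
theorem xi_corner_formula : ∀ ℓ : ℝ, 0 < ℓ → ∀ n : ℕ, 2 ≤ n →
    xi' n ℓ =
      ((2 : ℝ) ^ ((n : ℝ) * ℓ + 1) + (2 / 3) * (1 + (3 : ℝ) ^ (ℓ / 2)) +
        ((2 : ℝ) ^ ((n : ℝ) * ℓ) * (1 + (Real.sqrt 3 / 2) ^ ℓ) - (2 : ℝ) ^ ℓ -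
          (2 * Real.sqrt 3) ^ ℓ) / ((2 : ℝ) ^ ℓ - 1)) /
      (2 * (n : ℝ) + 1 / 3) := by
  intro ℓ hℓ n hn
  have hq0 : (0 : ℝ) < 2 ^ ℓ := by positivity
  have hq1 : (2 : ℝ) ^ ℓ ≠ 1 := (Real.one_lt_rpow (by norm_num) hℓ).ne'
  have e1 : (2 : ℝ) ^ ((n : ℝ) * ℓ) = (2 ^ ℓ) ^ n := by
    rw [mul_comm, Real.rpow_mul_natCast (by norm_num)]
  have e2 : (3 : ℝ) ^ (ℓ / 2) = Real.sqrt 3 ^ ℓ := by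
    rw [Real.sqrt_eq_rpow, ← Real.rpow_mul (by norm_num)]
    ring_nf
  have e3 (j : ℕ) : ((2 : ℝ) ^ j) ^ ℓ = (2 ^ ℓ) ^ j := by
    rw [← Real.rpow_natCast_mul (by norm_num), mul_comm, Real.rpow_mul_natCast (by norm_num)]
  have e4 (j : ℕ) : ((2 : ℝ) ^ j * sq3) ^ ℓ = (2 ^ ℓ) ^ j * sq3 ^ ℓ := by
    rw [Real.mul_rpow (by positivity) sq3_pos.le, e3]
  have hden : ∑ x ∈ C n, F n x = 2 * (n : ℝ) + 1 / 3 := by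
    have h := sum_corner hn (fun _ => 1)
    simp only [one_mul, Finset.sum_const, Finset.card_range, nsmul_eq_mul, mul_one] at h
    rw [h]
    push_cast [Nat.cast_sub hn, Nat.cast_sub (one_le_two.trans hn)]
    ring
  rw [xi', hden, sum_corner hn (· ^ ℓ)]
  congr 1
  obtain ⟨m, rfl⟩ := Nat.exists_eq_add_of_le' hn
  simp only [e3, e4, Real.one_rpow, show m + 2 - 1 = m + 1 by omega, Nat.add_sub_cancel]
  simp only [pow_succ _ (_ : ℕ), ← Finset.sum_mul]
  rw [Real.rpow_add (by norm_num), e1, e2, Real.div_rpow (Real.sqrt_nonneg 3) (by norm_num),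
    Real.mul_rpow (by norm_num) (Real.sqrt_nonneg 3), Real.rpow_one, geom_sum_eq hq1,
    geom_sum_eq hq1, sq3]
  have := sub_ne_zero.2 hq1
  field_simp
  ring

end SierpinskiGasket
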